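/- arXiv:1408.0871 — 5 statements merged into one kernel-verified Lean document; each statement's English description precedes it below -/
import Mathlib

section
/- Let K be an algebraically closed field and let t ≥ 2, k ≥ 1 and n be positive integers satisfying 2n ≥ t(k−1) + 2k. Then for every t-tuple φ₁,…,φ_t of alternating bilinear forms on K^n there exists a k-dimensional subspace W ⊆ K^n that is simultaneously totally isotropic for all the forms, i.e. φ_i(x,y) = 0 for all x,y ∈ W and all i = 1,…,t. -/
/-- The coefficients of the relations `ω s (e j) + α s * ω s (f (j + 1)) + ω (σ s) (f j)`, in the
space with basis `f 0, …, f q, e 0, …, e (q - 1)`. -/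
def oddRel (K : Type*) [Field K] {t : ℕ} (σ : Fin t → Fin t) (α : Fin t → K) (q : ℕ)
    (r : Fin q × Fin t) (i : Fin t) (a : Fin (q + 1) ⊕ Fin q) : K :=
  (if i = r.2 then ((if a = Sum.inr r.1 then 1 else 0) +
    (if a = Sum.inl r.1.succ then α r.2 else 0)) else 0) +
  (if i = σ r.2 then (if a = Sum.inl r.1.castSucc then 1 else 0) else 0)

theorem sum_oddRel {K : Type*} [Field K] {t : ℕ} (σ : Fin t → Fin t) (α : Fin t → K) (q : ℕ)
    (r : Fin q × Fin t) (g : Fin t → Fin (q + 1) ⊕ Fin q → K) :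
    ∑ i, ∑ a, oddRel K σ α q r i a * g i a =
      g r.2 (.inr r.1) + α r.2 * g r.2 (.inl r.1.succ) + g (σ r.2) (.inl r.1.castSucc) := by
  simp [oddRel, add_mul, ite_mul, Finset.sum_add_distrib, -Fintype.sum_sum_type]

theorem hankel_eq_zero {K : Type*} [Field K] {q : ℕ} (F : Fin (q + 1) → Fin (q + 1) → K)
    (hF : ∀ i, F i i = 0) (h0 : ∀ j : Fin q, F j.castSucc j.succ = 0)
    (hH : ∀ l j : Fin q, F l.castSucc j.succ = F l.succ j.castSucc) : ∀ i j, F i j = 0 := by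
  have key : ∀ d : ℕ, ∀ i j : ℕ, ∀ (hi : i < q + 1) (hj : j < q + 1), j = i + d →
      F ⟨i, hi⟩ ⟨j, hj⟩ = 0 ∧ F ⟨j, hj⟩ ⟨i, hi⟩ = 0 := by
    intro d
    induction d using Nat.strong_induction_on with
    | _ d ih =>
      intro i j hi hj hd
      rcases d with _ | _ | d
      · subst hd; exact ⟨hF _, hF _⟩
      · subst hd
        have h1 := h0 ⟨i, by omega⟩
        have h2 := hH ⟨i, by omega⟩ ⟨i, by omega⟩
        simp only [Fin.castSucc_mk, Fin.succ_mk] at h1 h2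
        exact ⟨h1, h2 ▸ h1⟩
      · obtain ⟨j, rfl⟩ : ∃ j', j = j' + 1 := ⟨j - 1, by omega⟩
        have h1 := hH ⟨i, by omega⟩ ⟨j, by omega⟩
        have h2 := hH ⟨j, by omega⟩ ⟨i, by omega⟩
        simp only [Fin.castSucc_mk, Fin.succ_mk] at h1 h2
        have h3 := ih d (by omega) (i + 1) j (by omega) (by omega) (by omega)
        exact ⟨h1.trans h3.1, h2 ▸ h3.2⟩
  intro i j
  rcases le_total i j with h | h
  · exact (key (j - i) i j i.2 j.2 (by have : (i:ℕ) ≤ j := h; omega)).1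
  · exact (key (i - j) j i j.2 i.2 (by have : (j:ℕ) ≤ i := h; omega)).2

theorem eq_zero_of_oddRel {K : Type*} [Field K] {t q : ℕ} (σ : Equiv.Perm (Fin t))
    (α : Fin t → K) (hα : ∀ i, α (σ i) ≠ α i)
    (ω : Fin t → Fin (q + 1) ⊕ Fin q → Fin (q + 1) ⊕ Fin q → K)
    (hs : ∀ i a, ω i a a = 0) (ha : ∀ i a b, ω i a b = - ω i b a)
    (h : ∀ (j : Fin q) (s : Fin t) (c : Fin (q + 1) ⊕ Fin q), ω s (.inr j) c +
      α s * ω s (.inl j.succ) c + ω (σ s) (.inl j.castSucc) c = 0) : ω = 0 := by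
  have hee : ∀ s j l, ω s (.inr j) (.inr l) = - (α s * α s * ω s (.inl l.succ) (.inl j.succ))
      - α s * ω (σ s) (.inl l.castSucc) (.inl j.succ)
      - α (σ s) * ω (σ s) (.inl l.succ) (.inl j.castSucc)
      - ω (σ (σ s)) (.inl l.castSucc) (.inl j.castSucc) := by
    intro s j l
    have h1 := h j s (.inr l)
    have h2 := h l s (.inl j.succ)
    have h3 := h l (σ s) (.inl j.castSucc)
    rw [ha _ (.inl j.succ), ha _ (.inl j.castSucc)] at h1
    linear_combination h1 + α s * h2 + h3
  have hff : ∀ s i j, ω s (.inl i) (.inl j) = 0 := by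
    intro s
    obtain ⟨s, rfl⟩ := σ.surjective s
    have hne := sub_ne_zero.2 (hα s)
    apply hankel_eq_zero (fun i j => ω (σ s) (.inl i) (.inl j))
    · intro i; exact hs _ _
    · intro j
      have h1 := hee s j j
      rw [hs, hs, hs, ha _ (.inl j.succ)] at h1
      apply (mul_eq_zero_iff_left hne).1
      linear_combination -h1
    · intro l j
      have h1 := hee s j l
      have h2 := hee s l j
      rw [ha, h2] at h1
      rw [ha s (.inl j.succ), ha (σ s) (.inl j.castSucc), ha (σ s) (.inl j.succ),
        ha (σ (σ s)) (.inl j.castSucc)] at h1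
      rw [← sub_eq_zero]
      apply (mul_eq_zero_iff_left hne).1
      linear_combination -h1
  have hef : ∀ s j i, ω s (.inr j) (.inl i) = 0 := by
    intro s j i
    have h1 := h j s (.inl i)
    simpa [hff] using h1
  ext s a b
  rcases a with a | a <;> rcases b with b | b
  · exact hff _ _ _
  · rw [ha, hef]; simp
  · exact hef _ _ _
  · rw [hee]; simp [hff]

/-- A family of `t`-tuples of vectors is separating when contraction against it detects all
`t`-tuples of alternating matrices. -/
def IsSeparating {K μ κ : Type*} [Field K] [Fintype κ] {t : ℕ} (C : μ → Fin t → κ → K) : Prop :=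
  ∀ ω : Fin t → κ → κ → K, (∀ i a, ω i a a = 0) → (∀ i a b, ω i a b = - ω i b a) →
    (∀ r c, ∑ i, ∑ a, C r i a * ω i a c = 0) → ω = 0

theorem isSeparating_oddRel {K : Type*} [Field K] {t q : ℕ} (σ : Equiv.Perm (Fin t))
    (α : Fin t → K) (hα : ∀ i, α (σ i) ≠ α i) : IsSeparating (oddRel K σ α q) := by
  intro ω hs ha h
  refine eq_zero_of_oddRel σ α hα ω hs ha fun j s c => ?_
  exact (sum_oddRel σ α q (j, s) fun i a => ω i a c).symm.trans (h (j, s) c)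

/-- The coefficients `oddRel` together with relations involving one more basis vector. -/
def evenRel (K : Type*) [Field K] {t p : ℕ} (σ : Fin t → Fin t) (τ : Fin p → Fin t)
    (α : Fin t → K) (q : ℕ) :
    (Fin q × Fin t) ⊕ Fin p → Fin t → Option (Fin (q + 1) ⊕ Fin q) → K
  | .inl r, i, some a => oddRel K σ α q r i a
  | .inl _, _, none => 0
  | .inr x, i, some a => if i = σ (τ x) then (if a = Sum.inl (Fin.last q) then 1 else 0) else 0
  | .inr x, i, none => if i = τ x then 1 else 0

theorem isSeparating_evenRel {K : Type*} [Field K] {t p q : ℕ} (σ : Equiv.Perm (Fin t))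
    (τ : Fin p → Fin t) (hτ : ∀ i, (∃ x, i = τ x) ∨ ∃ x, i = σ (τ x))
    (α : Fin t → K) (hα : ∀ i, α (σ i) ≠ α i) : IsSeparating (evenRel K σ τ α q) := by
  intro ω hs ha h
  have hodd : ∀ (j : Fin q) (s : Fin t) c, ω s (some (.inr j)) c +
      α s * ω s (some (.inl j.succ)) c + ω (σ s) (some (.inl j.castSucc)) c = 0 := by
    intro j s c
    have h1 := h (.inl (j, s)) c
    simp only [Fintype.sum_option, evenRel, zero_mul, zero_add] at h1
    exact (sum_oddRel σ α q (j, s) fun i a => ω i (some a) c).symm.trans h1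
  have hnew : ∀ (x : Fin p) c, ω (τ x) none c +
      ω (σ (τ x)) (some (.inl (Fin.last q))) c = 0 := by
    intro x c
    have h1 := h (.inr x) c
    simpa [Fintype.sum_option, evenRel, Finset.sum_add_distrib, -Fintype.sum_sum_type] using h1
  have hsome : ∀ i a b, ω i (some a) (some b) = 0 := by
    have := eq_zero_of_oddRel σ α hα (fun i a b => ω i (some a) (some b))
      (fun i a => hs i _) (fun i a b => ha i _ _) (fun j s c => hodd j s (some c))
    intro i a b
    exact congrFun (congrFun (congrFun this i) a) b
  have hτ0 : ∀ x b, ω (τ x) none (some b) = 0 := by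
    intro x b
    simpa [hsome] using hnew x (some b)
  have hf : ∀ d : Fin (q + 1), ∀ i, ω i none (some (.inl d)) = 0 := by
    intro d
    induction d using Fin.reverseInduction with
    | last =>
      intro i
      rcases hτ i with ⟨x, rfl⟩ | ⟨x, rfl⟩
      · exact hτ0 _ _
      · have := hnew x none
        rw [hs, zero_add] at this
        rw [ha, this, neg_zero]
    | cast j ih =>
      intro i
      rcases hτ i with ⟨x, rfl⟩ | ⟨x, rfl⟩
      · exact hτ0 _ _
      · have := hodd j (τ x) none
        rw [ha _ _ none, hτ0, ha _ _ none, hτ0] at this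
        rw [ha]
        simpa using this
  have hn : ∀ i b, ω i none (some b) = 0 := by
    intro i b
    rcases b with d | j
    · exact hf d i
    · have := hodd j i none
      rw [ha _ (some (.inl _)) none, hf, ha _ (some (.inl _)) none, hf] at this
      rw [ha]
      simpa using this
  ext i a b
  rcases a with _ | a <;> rcases b with _ | b
  · exact hs _ _
  · exact hn _ _
  · rw [ha, hn]; simp
  · exact hsome _ _ _

theorem IsSeparating.reindex {K μ ν κ ι : Type*} [Field K] [Fintype κ] [Fintype ι] {t : ℕ}
    {C : μ → Fin t → κ → K} (hC : IsSeparating C) (e : μ ↪ ν) (f : ι ≃ κ) :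
    IsSeparating (fun r i a => Function.extend e C 0 r i (f a)) := by
  intro ω hs ha h
  have := hC (fun i a b => ω i (f.symm a) (f.symm b)) (fun _ _ => hs _ _ ) (fun _ _ _ => ha _ _ _)
    (fun r c => by
      have h1 := h (e r) (f.symm c)
      simp only [e.injective.extend_apply] at h1
      rw [← h1]
      refine Finset.sum_congr rfl fun i _ => ?_
      exact (Fintype.sum_equiv f _ _ (by simp)).symm)
  ext i a b
  simpa using congrFun (congrFun (congrFun this i) (f a)) (f b)

theorem exists_isSeparating (K : Type*) [Field K] [Infinite K] {t k m : ℕ} (ht : 2 ≤ t)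
    (hk : 1 ≤ k) (h : t * (k - 1) ≤ 2 * m) :
    ∃ C : Fin m → Fin t → Fin k → K, IsSeparating C := by
  obtain ⟨t, rfl⟩ : ∃ t', t = t' + 2 := ⟨t - 2, by omega⟩
  let α : Fin (t + 2) ↪ K := Function.Embedding.trans (Fin.valEmbedding) (Infinite.natEmbedding K)
  have hα : ∀ i, α (finRotate _ i) ≠ α i := by
    intro i hi
    have := α.injective hi
    simp at this
  obtain ⟨q, rfl | rfl⟩ : ∃ q, k = 2 * q + 1 ∨ k = 2 * q + 2 := ⟨(k - 1) / 2, by omega⟩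
  · have hc : Fintype.card (Fin q × Fin (t + 2)) ≤ Fintype.card (Fin m) := by
      simp only [Fintype.card_prod, Fintype.card_fin]
      have : 2 * q + 1 - 1 = 2 * q := rfl
      rw [this] at h
      linarith
    obtain ⟨e⟩ := Function.Embedding.nonempty_of_card_le hc
    exact ⟨_, (isSeparating_oddRel (finRotate _) α hα).reindex e
      (Fintype.equivOfCardEq (by simp; ring))⟩
  · let τ : Fin ((t + 3) / 2) → Fin (t + 2) := fun x => ⟨2 * x, by omega⟩
    have hτ : ∀ i, (∃ x, i = τ x) ∨ ∃ x, i = finRotate _ (τ x) := by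
      intro i
      rcases Nat.even_or_odd' i with ⟨c, hc | hc⟩
      · exact .inl ⟨⟨c, by omega⟩, Fin.ext hc⟩
      · refine .inr ⟨⟨c, by omega⟩, ?_⟩
        rw [finRotate_of_lt (by dsimp only; omega)]
        exact Fin.ext hc
    have hc : Fintype.card ((Fin q × Fin (t + 2)) ⊕ Fin ((t + 3) / 2)) ≤ Fintype.card (Fin m) := by
      simp only [Fintype.card_sum, Fintype.card_prod, Fintype.card_fin]
      have : 2 * q + 2 - 1 = 2 * q + 1 := rfl
      rw [this] at h
      have : (t + 2) * (2 * q + 1) = 2 * (q * (t + 2)) + (t + 2) := by ring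
      omega
    obtain ⟨e⟩ := Function.Embedding.nonempty_of_card_le hc
    exact ⟨_, (isSeparating_evenRel (finRotate _) τ hτ α hα).reindex e
      (Fintype.equivOfCardEq (by simp; ring))⟩

open PowerSeries in
/-- An operator on tuples of power series preserving congruences modulo powers of `X` has a fixed
point after multiplication by `X`. -/
theorem PowerSeries.exists_eq_X_mul {R N : Type*} [CommRing R] (G : (N → R⟦X⟧) → N → R⟦X⟧)
    (hG : ∀ d x y, (∀ i, X ^ d ∣ x i - y i) → ∀ i, X ^ d ∣ G x i - G y i) :
    ∃ x, ∀ i, x i = X * G x i := by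
  let s : ℕ → N → R⟦X⟧ := fun d => Nat.rec 0 (fun _ x i => X * G x i) d
  have hs : ∀ d i, s (d + 1) i = X * G (s d) i := fun _ _ => rfl
  have h1 : ∀ d i, X ^ d ∣ s (d + 1) i - s d i := by
    intro d
    induction d with
    | zero => simp
    | succ d ih =>
      intro i
      rw [hs (d + 1), hs d, ← mul_sub, pow_succ']
      exact mul_dvd_mul_left _ (hG d _ _ ih i)
  have h2 : ∀ d e i, X ^ d ∣ s (d + e) i - s d i := by
    intro d e i
    induction e with
    | zero => simp
    | succ e ih =>
      have := (pow_dvd_pow X (Nat.le_add_right d e)).trans (h1 (d + e) i)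
      simpa [add_assoc] using dvd_add this ih
  let x : N → R⟦X⟧ := fun i => PowerSeries.mk fun d => coeff d (s (d + 1) i)
  have hx : ∀ d i, X ^ d ∣ x i - s d i := by
    intro d i
    rw [X_pow_dvd_iff]
    intro c hc
    obtain ⟨e, rfl⟩ := Nat.exists_eq_add_of_le (Nat.succ_le_of_lt hc)
    have := (X_pow_dvd_iff.1 (h2 (c + 1) e i)) c (Nat.lt_succ_self c)
    simp only [map_sub, x, coeff_mk] at this ⊢
    linear_combination -this
  refine ⟨x, fun i => ?_⟩
  rw [← sub_eq_zero]
  ext c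
  have h3 : X ^ (c + 1) ∣ x i - X * G x i := by
    have h4 : X ^ (c + 1) ∣ X * G x i - s (c + 1) i := by
      rw [hs, ← mul_sub, pow_succ']
      exact mul_dvd_mul_left _ (hG c _ _ (hx c) i)
    simpa using dvd_sub (hx (c + 1) i) h4
  simpa using X_pow_dvd_iff.1 h3 c (Nat.lt_succ_self c)

/-- The value of the bilinear form with Gram matrix `M` on two coordinate vectors. -/
def gramValue {R ι : Type*} [CommRing R] [Fintype ι] (M : ι → ι → R) (v w : ι → R) : R :=
  ∑ p, ∑ q, M p q * (v p * w q)

theorem gramValue_self {R ι : Type*} [CommRing R] [Fintype ι] {M : ι → ι → R}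
    (hd : ∀ p, M p p = 0) (ha : ∀ p q, M p q = - M q p) (v : ι → R) : gramValue M v v = 0 := by
  classical
  rw [gramValue, ← Fintype.sum_prod_type']
  refine Finset.sum_involution (fun x _ => x.swap) ?_ ?_ ?_ ?_
  · rintro ⟨p, q⟩ -
    simp only [Prod.swap]
    rw [ha p q]; ring
  · rintro ⟨p, q⟩ - h1 h2
    simp only [Prod.swap, Prod.mk.injEq] at h2
    obtain rfl := h2.1
    simp [hd] at h1
  · simp
  · simp

theorem gramValue_swap {R ι : Type*} [CommRing R] [Fintype ι] {M : ι → ι → R}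
    (ha : ∀ p q, M p q = - M q p) (v w : ι → R) : gramValue M w v = - gramValue M v w := by
  rw [gramValue, gramValue, Finset.sum_comm, ← Finset.sum_neg_distrib]
  refine Finset.sum_congr rfl fun p _ => ?_
  rw [← Finset.sum_neg_distrib]
  refine Finset.sum_congr rfl fun q _ => ?_
  rw [ha q p]; ring

theorem gramValue_add_smul {R ι : Type*} [CommRing R] [Fintype ι] (M N : ι → ι → R) (c : R)
    (v w : ι → R) :
    gramValue (fun p q => M p q + c * N p q) v w = gramValue M v w + c * gramValue N v w := by
  simp only [gramValue, Finset.mul_sum, ← Finset.sum_add_distrib]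
  refine Finset.sum_congr rfl fun p _ => Finset.sum_congr rfl fun q _ => by ring

theorem map_gramValue {R S ι : Type*} [CommRing R] [CommRing S] [Fintype ι] (f : R →+* S)
    (M : ι → ι → R) (v w : ι → R) :
    f (gramValue M v w) = gramValue (fun p q => f (M p q)) (fun p => f (v p)) fun p => f (w p) := by
  simp [gramValue]

theorem gramValue_eq_mul_apply {R ι κ : Type*} [CommRing R] [Fintype ι] (M : ι → ι → R)
    (A : Matrix κ ι R) (a b : κ) :
    gramValue M (A a) (A b) = (A * Matrix.of M * A.transpose) a b := by
  simp only [gramValue, Matrix.mul_apply, Finset.sum_mul, Matrix.of_apply, Matrix.transpose_apply]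
  rw [Finset.sum_comm]
  exact Finset.sum_congr rfl fun q _ => Finset.sum_congr rfl fun p _ => by ring

theorem gramValue_mul_eq_zero {R ι κ : Type*} [CommRing R] [Fintype ι] [Fintype κ]
    {M : ι → ι → R} {A : Matrix κ ι R} (h : ∀ a b, gramValue M (A a) (A b) = 0)
    (g : Matrix κ κ R) (a b : κ) : gramValue M ((g * A) a) ((g * A) b) = 0 := by
  have h0 : A * Matrix.of M * A.transpose = 0 := by
    ext a b
    rw [← gramValue_eq_mul_apply, h, Matrix.zero_apply]
  have h1 : g * A * Matrix.of M * (g * A).transpose =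
      g * (A * Matrix.of M * A.transpose) * g.transpose := by
    simp only [Matrix.transpose_mul, Matrix.mul_assoc]
  rw [gramValue_eq_mul_apply, h1, h0]
  simp

theorem exists_rightInverse_of_vecMul_injective {K J N : Type*} [Field K] [Fintype J] [Fintype N]
    [DecidableEq J] [DecidableEq N] (Λ : Matrix J N K)
    (h : ∀ y, Matrix.vecMul y Λ = 0 → y = 0) : ∃ S : Matrix N J K, Λ * S = 1 := by
  obtain ⟨g, hg⟩ := LinearMap.exists_leftInverse_of_injective (Matrix.toLin' Λ.transpose)
    (LinearMap.ker_eq_bot'.2 fun y hy => h y (by simpa [Matrix.mulVec_transpose] using hy))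
  refine ⟨(LinearMap.toMatrix' g).transpose, ?_⟩
  have := congrArg LinearMap.toMatrix' hg
  rw [LinearMap.toMatrix'_comp, LinearMap.toMatrix'_toLin', LinearMap.toMatrix'_id] at this
  rw [← Matrix.transpose_transpose Λ, ← Matrix.transpose_mul, this, Matrix.transpose_one]

/-- A matrix of full row rank over a valued field is row equivalent to one with integral entries
containing an identity submatrix. -/
theorem exists_submatrix_eq_one_of_valuationSubring {L ι : Type*} [Field L] [Finite ι] {k : ℕ}
    (O : ValuationSubring L) (A : Matrix (Fin k) ι L) (I₀ : Fin k → ι)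
    (h₀ : (A.submatrix id I₀).det ≠ 0) :
    ∃ (g : Matrix (Fin k) (Fin k) L) (I : Fin k → ι),
      (g * A).submatrix id I = 1 ∧ ∀ a p, (g * A) a p ∈ O := by
  classical
  have : Nonempty (Fin k → ι) := ⟨I₀⟩
  obtain ⟨I, hI⟩ := Finite.exists_max fun I : Fin k → ι => O.valuation (A.submatrix id I).det
  have hv : O.valuation (A.submatrix id I).det ≠ 0 := by
    intro h
    have h1 := hI I₀
    rw [h] at h1
    exact h₀ (by simpa using h1)
  have hdet : IsUnit (A.submatrix id I).det := by
    rw [isUnit_iff_ne_zero]; intro h; simp [h] at hv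
  refine ⟨(A.submatrix id I)⁻¹, I, ?_, fun a p => ?_⟩
  · rw [← Matrix.nonsing_inv_mul _ hdet]
    ext a b
    simp [Matrix.mul_apply]
  · have h1 := congrFun (Matrix.det_smul_inv_mulVec_eq_cramer (A.submatrix id I)
      (fun c => A c p) hdet) a
    have h2 : ((A.submatrix id I).updateCol a fun c => A c p) =
        A.submatrix id (Function.update I a p) := by
      ext c b
      by_cases hb : b = a
      · subst hb; simp
      · simp [hb]
    rw [Matrix.cramer_apply, h2, Pi.smul_apply, smul_eq_mul] at h1
    have h3 := hI (Function.update I a p)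
    rw [← h1, map_mul] at h3
    rw [← O.valuation_le_one_iff]
    exact (mul_le_iff_le_one_right (zero_lt_iff.2 hv)).1 h3

theorem exists_valuationSubring_X_notMem (K : Type*) [Field K] :
    ∃ O : ValuationSubring (FractionRing (PowerSeries K)),
      (∀ c : K, algebraMap K _ c ∈ O) ∧
        algebraMap (PowerSeries K) (FractionRing (PowerSeries K)) PowerSeries.X ∉ O := by
  set L := FractionRing (PowerSeries K)
  by_contra! hcon
  have hmem : algebraMap (PowerSeries K) L PowerSeries.X ∈
      (⨅ V : {V : ValuationSubring L // Set.range (algebraMap K L) ⊆ V.toSubring},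
        V.1.toSubring) := by
    rw [Subring.mem_iInf]
    rintro ⟨V, hV⟩
    exact hcon V fun c => hV ⟨c, rfl⟩
  rw [iInf_valuationSubring_superset] at hmem
  obtain ⟨p, hp, hpx⟩ := hmem
  have hsub : ∀ c : K, algebraMap K L c ∈ Subring.closure (Set.range (algebraMap K L)) :=
    fun c => Subring.subset_closure ⟨c, rfl⟩
  have hsurj : Function.Surjective ((algebraMap K L).codRestrict _ hsub) := by
    rintro ⟨y, hy⟩
    rw [← RingHom.coe_range, Subring.closure_eq] at hy
    obtain ⟨c, rfl⟩ := hy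
    exact ⟨c, rfl⟩
  obtain ⟨f, rfl⟩ := Polynomial.map_surjective _ hsurj p
  have hcomp : (algebraMap (Subring.closure (Set.range (algebraMap K L))) L).comp
      ((algebraMap K L).codRestrict _ hsub) =
      (algebraMap (PowerSeries K) L).comp PowerSeries.C := by
    ext c
    exact IsScalarTower.algebraMap_apply K (PowerSeries K) L c
  rw [Polynomial.eval₂_map, hcomp, ← Polynomial.hom_eval₂, Polynomial.eval₂_C_X_eq_coe,
    map_eq_zero_iff _ (IsFractionRing.injective (PowerSeries K) L)] at hpx
  rw [Polynomial.coe_eq_zero_iff] at hpx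
  rw [hpx, Polynomial.map_zero] at hp
  exact hp.ne_zero rfl

theorem IsAlgClosed.nonempty_algHom_adjoin {K F : Type*} [Field K] [IsAlgClosed K] [Field F]
    [Algebra K F] (s : Set F) (hs : s.Finite) :
    Nonempty (Algebra.adjoin K s →ₐ[K] K) := by
  have : Algebra.FiniteType K (Algebra.adjoin K s) :=
    (Subalgebra.fg_iff_finiteType _).1 ⟨hs.toFinset, by simp⟩
  obtain ⟨m, hm⟩ := Ideal.exists_maximal (Algebra.adjoin K s)
  let := Ideal.Quotient.field m
  have := finite_of_finite_type_of_isJacobsonRing K (Algebra.adjoin K s ⧸ m)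
  let e := AlgEquiv.ofBijective (Algebra.ofId K (Algebra.adjoin K s ⧸ m))
    IsAlgClosed.algebraMap_bijective_of_isIntegral
  exact ⟨e.symm.toAlgHom.comp (Ideal.Quotient.mkₐ K m)⟩

/-- The coordinates of the vectors spanning the graph of the matrix `x`. -/
def graphRow {R : Type*} [CommRing R] {k m : ℕ} (x : Fin m × Fin k → R) (a : Fin k) :
    Fin k ⊕ Fin m → R :=
  Sum.elim (Pi.single a 1) fun r => x (r, a)

/-- The alternating Gram matrix whose only nonzero blocks pair the two coordinate subspaces
through `C`. -/
def pairingGram {R : Type*} [CommRing R] {k m : ℕ} (C : Fin m → Fin k → R) :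
    Fin k ⊕ Fin m → Fin k ⊕ Fin m → R
  | .inl a, .inr r => C r a
  | .inr r, .inl a => - C r a
  | _, _ => 0

theorem pairingGram_self {R : Type*} [CommRing R] {k m : ℕ} (C : Fin m → Fin k → R)
    (p : Fin k ⊕ Fin m) : pairingGram C p p = 0 := by
  rcases p with p | p <;> rfl

theorem pairingGram_swap {R : Type*} [CommRing R] {k m : ℕ} (C : Fin m → Fin k → R)
    (p q : Fin k ⊕ Fin m) : pairingGram C p q = - pairingGram C q p := by
  rcases p with p | p <;> rcases q with q | q <;> simp [pairingGram]

theorem map_pairingGram {R S : Type*} [CommRing R] [CommRing S] (f : R →+* S) {k m : ℕ}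
    (C : Fin m → Fin k → R) (p q : Fin k ⊕ Fin m) :
    f (pairingGram C p q) = pairingGram (fun r a => f (C r a)) p q := by
  rcases p with p | p <;> rcases q with q | q <;> simp [pairingGram]

theorem gramValue_pairingGram_graphRow {R : Type*} [CommRing R] {k m : ℕ}
    (C : Fin m → Fin k → R) (x : Fin m × Fin k → R) (a b : Fin k) :
    gramValue (pairingGram C) (graphRow x a) (graphRow x b) =
      ∑ r, (C r a * x (r, b) - C r b * x (r, a)) := by
  simp only [gramValue, Fintype.sum_sum_type, pairingGram, graphRow, Sum.elim_inl, Sum.elim_inr,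
    zero_mul, Finset.sum_const_zero, zero_add, add_zero]
  simp [Pi.single_apply, sub_eq_add_neg, Finset.sum_add_distrib]

theorem dvd_gramValue_graphRow_sub {R : Type*} [CommRing R] {k m : ℕ}
    (M : Fin k ⊕ Fin m → Fin k ⊕ Fin m → R) {c : R} {x y : Fin m × Fin k → R}
    (h : ∀ i, c ∣ x i - y i) (a b : Fin k) :
    c ∣ gramValue M (graphRow x a) (graphRow x b) - gramValue M (graphRow y a) (graphRow y b) := by
  have hrow : ∀ a p, c ∣ graphRow x a p - graphRow y a p := by
    intro a p
    rcases p with p | p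
    · simp [graphRow]
    · exact h _
  simp only [gramValue, ← Finset.sum_sub_distrib, ← mul_sub]
  exact Finset.dvd_sum fun p _ => Finset.dvd_sum fun q _ =>
    (dvd_mul_sub_mul (hrow a p) (hrow b q)).mul_left _

/-- The linear map sending a matrix to the first-order change of the pairing forms. -/
def tangentMatrix {K : Type*} [Field K] {t k m : ℕ} (C : Fin m → Fin t → Fin k → K) :
    Matrix {j : Fin t × Fin k × Fin k // j.2.1 < j.2.2} (Fin m × Fin k) K :=
  fun j s => (if s.2 = j.1.2.2 then C s.1 j.1.1 j.1.2.1 else 0) -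
    if s.2 = j.1.2.1 then C s.1 j.1.1 j.1.2.2 else 0

theorem IsSeparating.eq_zero_of_vecMul_tangentMatrix {K : Type*} [Field K] {t k m : ℕ}
    {C : Fin m → Fin t → Fin k → K} (hC : IsSeparating C)
    (y : {j : Fin t × Fin k × Fin k // j.2.1 < j.2.2} → K)
    (hy : Matrix.vecMul y (tangentMatrix C) = 0) : y = 0 := by
  let z : Fin t → Fin k → Fin k → K := fun i a b => if h : a < b then y ⟨(i, a, b), h⟩ else 0
  have hz := hC (fun i a b => z i a b - z i b a) (by simp) (by simp) (by
    intro r c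
    have h1 := congrFun hy (r, c)
    simp only [Matrix.vecMul, dotProduct, tangentMatrix, Pi.zero_apply] at h1
    rw [← h1]
    have h2 : ∀ f : Fin t × Fin k × Fin k → K,
        ∑ j : {j : Fin t × Fin k × Fin k // j.2.1 < j.2.2}, y j * f j.1 =
        ∑ i, ∑ a, ∑ b, z i a b * f (i, a, b) := by
      intro f
      have h3 : ∀ j : {j : Fin t × Fin k × Fin k // j.2.1 < j.2.2},
          y j * f j.1 = z j.1.1 j.1.2.1 j.1.2.2 * f j.1 := by
        rintro ⟨⟨i, a, b⟩, hj⟩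
        simp only [z]
        rw [dif_pos hj]
      simp only [h3]
      rw [← Finset.sum_subtype (Finset.univ.filter fun j : Fin t × Fin k × Fin k => j.2.1 < j.2.2)
        (by simp) (fun j => z j.1 j.2.1 j.2.2 * f j), Finset.sum_filter_of_ne]
      · simp only [Fintype.sum_prod_type]
      · intro j _ hj
        by_contra hlt
        simp [z, hlt] at hj
    rw [h2 fun j => (if c = j.2.2 then C r j.1 j.2.1 else 0) -
      if c = j.2.1 then C r j.1 j.2.2 else 0]
    refine Finset.sum_congr rfl fun i _ => ?_
    simp only [mul_sub, Finset.sum_sub_distrib, mul_ite, mul_zero, Finset.sum_ite_eq,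
      Finset.mem_univ, if_true]
    congr 1
    · exact Finset.sum_congr rfl fun a _ => mul_comm _ _
    · rw [Finset.sum_comm]
      simp [mul_comm])
  ext ⟨⟨i, a, b⟩, hj⟩
  have h1 := congrFun (congrFun (congrFun hz i) a) b
  simp only [z] at h1
  rw [dif_pos hj, dif_neg (not_lt.2 (le_of_lt hj))] at h1
  simpa using h1

theorem tangentMatrix_mulVec {K R : Type*} [Field K] [CommRing R] (f : K →+* R) {t k m : ℕ}
    (C : Fin m → Fin t → Fin k → K) (x : Fin m × Fin k → R)
    (j : {j : Fin t × Fin k × Fin k // j.2.1 < j.2.2}) :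
    ((tangentMatrix C).map f).mulVec x j =
      gramValue (pairingGram fun r a => f (C r j.1.1 a)) (graphRow x j.1.2.1)
        (graphRow x j.1.2.2) := by
  rw [gramValue_pairingGram_graphRow]
  simp only [Matrix.mulVec, dotProduct, Matrix.map_apply, tangentMatrix, Fintype.sum_prod_type]
  refine Finset.sum_congr rfl fun r _ => ?_
  simp [sub_mul, apply_ite f]

open PowerSeries in
/-- A graph isotropic for the pairing forms lifts to one isotropic for any first-order-in-`X`
deformation of them. -/
theorem IsSeparating.exists_graph_isotropic {K : Type*} [Field K] {t k m : ℕ}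
    {C : Fin m → Fin t → Fin k → K} (hC : IsSeparating C)
    (M : Fin t → Fin k ⊕ Fin m → Fin k ⊕ Fin m → K) (hd : ∀ i p, M i p p = 0)
    (ha : ∀ i p q, M i p q = - M i q p) :
    ∃ x : Fin m × Fin k → K⟦X⟧, ∀ i a b,
      gramValue (fun p q => PowerSeries.C (pairingGram (fun r c => C r i c) p q) +
        X * PowerSeries.C (M i p q)) (graphRow x a) (graphRow x b) = 0 := by
  obtain ⟨S, hS⟩ := exists_rightInverse_of_vecMul_injective (tangentMatrix C)
    hC.eq_zero_of_vecMul_tangentMatrix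
  let f : K →+* K⟦X⟧ := PowerSeries.C
  let Q (x : Fin m × Fin k → K⟦X⟧) (j : {j : Fin t × Fin k × Fin k // j.2.1 < j.2.2}) : K⟦X⟧ :=
    gramValue (fun p q => f (M j.1.1 p q)) (graphRow x j.1.2.1) (graphRow x j.1.2.2)
  obtain ⟨x, hx⟩ := PowerSeries.exists_eq_X_mul (fun x => (S.map f).mulVec (- Q x)) (by
    intro d x y h i
    simp only [Matrix.mulVec, dotProduct, ← Finset.sum_sub_distrib, ← mul_sub, Pi.neg_apply]
    refine Finset.dvd_sum fun j _ => Dvd.dvd.mul_left ?_ _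
    rw [neg_sub_neg, ← neg_sub, dvd_neg]
    exact dvd_gramValue_graphRow_sub _ h _ _)
  have hx' : x = (X : K⟦X⟧) • (S.map f).mulVec (- Q x) := funext hx
  have hlt : ∀ i a b, a < b →
      gramValue (fun p q => f (pairingGram (fun r c => C r i c) p q) +
        X * f (M i p q)) (graphRow x a) (graphRow x b) = 0 := by
    intro i a b hab
    have h1 := tangentMatrix_mulVec f C x ⟨(i, a, b), hab⟩
    have h2 : ((tangentMatrix C).map f).mulVec x = (X : K⟦X⟧) • (- Q x) := by
      conv_lhs => rw [hx']
      rw [Matrix.mulVec_smul, Matrix.mulVec_mulVec, ← Matrix.map_mul, hS,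
        Matrix.map_one _ f.map_zero f.map_one, Matrix.one_mulVec]
    rw [h2] at h1
    simp only [map_pairingGram]
    rw [gramValue_add_smul, ← h1]
    simp [Q]
  have hgd : ∀ i p, f (pairingGram (fun r c => C r i c) p p) + X * f (M i p p) = 0 := by
    intro i p
    simp [pairingGram_self, hd]
  have hga : ∀ i p q, f (pairingGram (fun r c => C r i c) p q) + X * f (M i p q) =
      -(f (pairingGram (fun r c => C r i c) q p) + X * f (M i q p)) := by
    intro i p q
    rw [pairingGram_swap, ha i p q, map_neg, map_neg]; ring
  refine ⟨x, fun i a b => ?_⟩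
  rcases lt_trichotomy a b with hab | rfl | hab
  · exact hlt i a b hab
  · exact gramValue_self (hgd i) (hga i) _
  · exact (gramValue_swap (hga i) _ _).trans (by rw [hlt i b a hab, neg_zero])

/-- Normalized common isotropic vectors over an extension field descend to an algebraically
closed base field. -/
theorem exists_isotropic_rows_of_ringHom {K F ι κ T : Type*} [Field K] [IsAlgClosed K] [Field F]
    [Fintype ι] [Finite κ] [DecidableEq κ] (f : K →+* F) (M : T → ι → ι → K) (I : κ → ι)
    (v : κ → ι → F) (hI : ∀ a b, v a (I b) = if a = b then 1 else 0)
    (hv : ∀ i a b, gramValue (fun p q => f (M i p q)) (v a) (v b) = 0) :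
    ∃ w : κ → ι → K, (∀ a b, w a (I b) = if a = b then 1 else 0) ∧
      ∀ i a b, gramValue (M i) (w a) (w b) = 0 := by
  let := f.toAlgebra
  let s : Set F := Set.range fun x : κ × ι => v x.1 x.2
  obtain ⟨φ⟩ := IsAlgClosed.nonempty_algHom_adjoin (K := K) s (Set.finite_range _)
  let y : κ → ι → Algebra.adjoin K s :=
    fun a p => ⟨v a p, Algebra.subset_adjoin ⟨(a, p), rfl⟩⟩
  refine ⟨fun a p => φ (y a p), fun a b => ?_, fun i a b => ?_⟩
  · have : y a (I b) = if a = b then 1 else 0 := by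
      apply Subtype.ext
      simp only [y, hI]
      split_ifs <;> rfl
    dsimp only
    rw [this]
    split_ifs <;> simp
  · have h1 : gramValue (fun p q => algebraMap K (Algebra.adjoin K s) (M i p q)) (y a) (y b) =
        0 := by
      apply Subtype.val_injective
      exact (map_gramValue (Algebra.adjoin K s).val.toRingHom _ _ _).trans (hv i a b)
    have h2 := (map_gramValue φ.toRingHom _ _ _).symm.trans (congrArg φ h1)
    simpa using h2

theorem IsSeparating.exists_isotropic_rows {K : Type*} [Field K] [IsAlgClosed K] {t k m : ℕ}
    {C : Fin m → Fin t → Fin k → K} (hC : IsSeparating C)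
    (M : Fin t → Fin k ⊕ Fin m → Fin k ⊕ Fin m → K) (hd : ∀ i p, M i p p = 0)
    (ha : ∀ i p q, M i p q = - M i q p) :
    ∃ (I : Fin k → Fin k ⊕ Fin m) (w : Fin k → Fin k ⊕ Fin m → K),
      (∀ a b, w a (I b) = if a = b then 1 else 0) ∧
        ∀ i a b, gramValue (M i) (w a) (w b) = 0 := by
  obtain ⟨x, hx⟩ := hC.exists_graph_isotropic M hd ha
  obtain ⟨O, hKO, hXO⟩ := exists_valuationSubring_X_notMem K
  let ι : PowerSeries K →+* FractionRing (PowerSeries K) := algebraMap _ _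
  let u : FractionRing (PowerSeries K) := ι PowerSeries.X
  have huO' : u ∉ O := hXO
  have hu : u ≠ 0 := fun h => huO' (h ▸ O.zero_mem)
  have huO : u⁻¹ ∈ O := (O.mem_or_inv_mem u).resolve_left huO'
  let A : Matrix (Fin k) (Fin k ⊕ Fin m) (FractionRing (PowerSeries K)) := fun a p => ι (graphRow x a p)
  obtain ⟨g, I, hgI, hgO⟩ := exists_submatrix_eq_one_of_valuationSubring O A Sum.inl (by
    have : A.submatrix id Sum.inl = 1 := by
      ext a b
      change ι ((Pi.single a 1 : Fin k → PowerSeries K) b) = _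
      rw [Matrix.one_apply, Pi.single_apply, apply_ite ι, map_one, map_zero]
      simp only [eq_comm]
    rw [this]
    simp)
  let j : K →+* O := (algebraMap K (FractionRing (PowerSeries K))).codRestrict O.toSubring hKO
  let N (i : Fin t) (p q : Fin k ⊕ Fin m) : K := pairingGram (fun r c => C r i c) p q
  let y : Fin k → Fin k ⊕ Fin m → O := fun a p => ⟨(g * A) a p, hgO a p⟩
  let w : O := ⟨u⁻¹, huO⟩
  have hyL : ∀ i a b, gramValue (fun p q => algebraMap K (FractionRing (PowerSeries K)) (M i p q) +
      u⁻¹ * algebraMap K (FractionRing (PowerSeries K)) (N i p q)) ((g * A) a) ((g * A) b) = 0 := by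
    intro i a b
    have h1 : ∀ a b, gramValue (fun p q => algebraMap K (FractionRing (PowerSeries K)) (N i p q) +
        u * algebraMap K (FractionRing (PowerSeries K)) (M i p q)) (A a) (A b) = 0 := by
      intro a b
      have := congrArg ι (hx i a b)
      rw [map_gramValue, map_zero] at this
      simp only [map_add, map_mul] at this
      exact this
    have h2 := gramValue_mul_eq_zero h1 g a b
    rw [gramValue_add_smul] at h2 ⊢
    have h3 := inv_mul_cancel₀ hu
    linear_combination u⁻¹ * h2 - gramValue (fun p q => algebraMap K _ (M i p q)) ((g * A) a)
      ((g * A) b) * h3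
  have hy : ∀ i a b, gramValue (fun p q => j (M i p q) + w * j (N i p q)) (y a) (y b) = 0 := by
    intro i a b
    apply Subtype.val_injective
    exact (map_gramValue O.subtype _ _ _).trans (hyL i a b)
  have hw : IsLocalRing.residue O w = 0 := by
    rw [IsLocalRing.residue_eq_zero_iff, IsLocalRing.mem_maximalIdeal, mem_nonunits_iff]
    intro hunit
    obtain ⟨z, hz⟩ := hunit.exists_right_inv
    have hz' : u⁻¹ * (z : (FractionRing (PowerSeries K))) = 1 := congrArg Subtype.val hz
    have : u = z := ((inv_mul_eq_one₀ hu).1 hz')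
    exact huO' (this ▸ z.2)
  obtain ⟨v, hv⟩ := exists_isotropic_rows_of_ringHom ((IsLocalRing.residue O).comp j) M I
    (fun a p => IsLocalRing.residue O (y a p)) (fun a b => by
      have : y a (I b) = if a = b then 1 else 0 := by
        apply Subtype.ext
        have h1 := congrFun (congrFun hgI a) b
        rw [Matrix.one_apply] at h1
        refine (show ((y a (I b) : O) : (FractionRing (PowerSeries K))) = _ from h1).trans ?_
        split_ifs <;> rfl
      rw [this]
      split_ifs <;> simp)
    (fun i a b => by
      have h1 := congrArg (IsLocalRing.residue O) (hy i a b)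
      rw [map_gramValue, map_zero] at h1
      simpa [hw] using h1)
  exact ⟨I, v, hv⟩

/-- Over an algebraically closed field, if t ≥ 2, k ≥ 1 and
2n ≥ t(k−1) + 2k, then any t alternating bilinear forms on K^n admit a common
k-dimensional totally isotropic subspace. -/
theorem exists_common_isotropic_subspace
    (K : Type) [Field K] [IsAlgClosed K] (n t k : ℕ)
    (ht : 2 ≤ t) (hk : 1 ≤ k) (h : t * (k - 1) + 2 * k ≤ 2 * n)
    (Φ : Fin t → LinearMap.BilinForm K (Fin n → K))
    (halt : ∀ r, (Φ r).IsAlt) :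
    ∃ W : Submodule K (Fin n → K), Module.finrank K W = k ∧
      ∀ x ∈ W, ∀ y ∈ W, ∀ r : Fin t, Φ r x y = 0 := by
  obtain ⟨m, rfl⟩ : ∃ m, n = k + m := Nat.exists_eq_add_of_le (by omega)
  have : Infinite K := IsAlgClosed.instInfinite
  obtain ⟨C, hC⟩ := exists_isSeparating K (m := m) ht hk (by omega)
  let b := (Pi.basisFun K (Fin (k + m))).reindex finSumFinEquiv.symm
  obtain ⟨I, w, hI, hw⟩ := hC.exists_isotropic_rows (fun i p q => Φ i (b p) (b q))
    (fun i p => halt i _) (fun i p q => ((halt i).neg_eq _ _).symm)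
  let v : Fin k → Fin (k + m) → K := fun a => ∑ p, w a p • b p
  have hΦ : ∀ i c d, Φ i (v c) (v d) = 0 := by
    intro i c d
    rw [← hw i c d]
    simp only [v, gramValue, map_sum, map_smul, LinearMap.sum_apply, LinearMap.smul_apply,
      smul_eq_mul, Finset.mul_sum]
    rw [Finset.sum_comm]
    exact Finset.sum_congr rfl fun p _ => Finset.sum_congr rfl fun q _ => by ring
  have hli : LinearIndependent K v := by
    rw [Fintype.linearIndependent_iff]
    intro c hc d
    have h1 := congrArg (fun z => b.repr z (I d)) hc
    have h2 : ∀ a, b.repr (v a) (I d) = if a = d then 1 else 0 := by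
      intro a
      rw [← hI a d, b.repr_sum_self]
    simpa [map_sum, Finsupp.finsetSum_apply, h2] using h1
  refine ⟨Submodule.span K (Set.range v), ?_, ?_⟩
  · rw [finrank_span_eq_card hli, Fintype.card_fin]
  · intro x hx y hy r
    induction hx using Submodule.span_induction with
    | mem x hx =>
      obtain ⟨c, rfl⟩ := hx
      induction hy using Submodule.span_induction with
      | mem y hy =>
        obtain ⟨d, rfl⟩ := hy
        exact hΦ r c d
      | zero => simp
      | add y z _ _ h1 h2 => simp [h1, h2]
      | smul s y _ h1 => simp [h1]
    | zero => simp
    | add y z _ _ h1 h2 => simp [h1, h2]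
    | smul s y _ h1 => simp [h1]
end

section
/- Let K be an algebraically closed field and n, t positive integers with 2 ≤ t ≤ n(n−1)/2. Then every finite-dimensional 2-step nilpotent Lie algebra L over K with dim L/[L,L] = n and dim [L,L] = t contains an abelian Lie subalgebra of dimension s = ⌊(2n + t² + 3t)/(t + 2)⌋. -/
/-- A Lie ring is 2-step nilpotent if `⁅L,⁅L,L⁆⁆ = 0` and `⁅L,L⁆ ≠ 0`. -/
def Is2StepNilpotent (L : Type) [LieRing L] : Prop :=
  (∀ x y z : L, ⁅x, ⁅y, z⁆⁆ = 0) ∧ ¬ (∀ x y : L, ⁅x, y⁆ = 0)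

/-- The commutator ideal `[L,L]`, viewed as a submodule of `L`. -/
def commSubmodule (K L : Type) [Field K] [LieRing L] [LieAlgebra K L] : Submodule K L :=
  LieSubmodule.toSubmodule ⁅(⊤ : LieIdeal K L), (⊤ : LieIdeal K L)⁆

/-- `L` belongs to the class `𝔑₂^K(n,t)`: it is 2-step nilpotent with
`dim L/[L,L] = n` and `dim [L,L] = t`. -/
def MemN2 (K L : Type) [Field K] [LieRing L] [LieAlgebra K L] (n t : ℕ) : Prop :=
  Is2StepNilpotent L ∧
    Module.finrank K (L ⧸ commSubmodule K L) = n ∧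
    Module.finrank K (commSubmodule K L) = t

/-- Property `Σ(n₀,t₀)`: `L` admits a surjective Lie algebra homomorphism onto some
finite-dimensional 2-step nilpotent Lie algebra `M` with `dim M/[M,M] = n₀`,
`dim [M,M] = t₀`. -/
def HasSigma (K : Type) [Field K] (L : Type) [LieRing L] [LieAlgebra K L]
    (n₀ t₀ : ℕ) : Prop :=
  ∃ (M : Type) (_ : LieRing M) (_ : LieAlgebra K M) (_ : Module.Finite K M),
    MemN2 K M n₀ t₀ ∧ ∃ f : L →ₗ⁅K⁆ M, Function.Surjective f

/-- A family of pairings `B` is nondegenerate if the only family of alternating matrices `A` with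
`∑ a, B aᵀ * A a = 0` is zero. -/
def IsNondegeneratePairing {K T C I : Type*} [Field K] [Fintype T] [Fintype I]
    (B : T → C → I → K) : Prop :=
  ∀ A : T → I → I → K, (∀ a i, A a i i = 0) → (∀ a i j, A a i j = -A a j i) →
    (∀ c j, ∑ a, ∑ i, B a c i * A a i j = 0) → A = 0

theorem IsNondegeneratePairing.exists_fin {K T C I : Type*} [Field K] [Fintype T] [Fintype I]
    [Fintype C] {B : T → C → I → K} (hB : IsNondegeneratePairing B) {m p : ℕ}
    (hm : Fintype.card I = m) (hp : Fintype.card C ≤ p) :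
    ∃ B' : T → Fin p → Fin m → K, IsNondegeneratePairing B' := by
  classical
  let e : I ≃ Fin m := Fintype.equivFinOfCardEq hm
  obtain ⟨g⟩ : Nonempty (C ↪ Fin p) :=
    Function.Embedding.nonempty_of_card_le (by simpa using hp)
  refine ⟨fun a c i => if h : ∃ c', g c' = c then B a h.choose (e.symm i) else 0, ?_⟩
  intro A h1 h2 h3
  have key := hB (fun a i j => A a (e i) (e j)) (fun a i => h1 _ _) (fun a i j => h2 _ _ _) (by
    intro c j
    have h := h3 (g c) (e j)
    have hc : ∃ c', g c' = g c := ⟨c, rfl⟩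
    have hcc : hc.choose = c := g.injective hc.choose_spec
    simp only [hc, dif_pos, hcc] at h
    rw [← h]
    refine Finset.sum_congr rfl fun a _ => ?_
    exact Fintype.sum_equiv e _ _ (by simp))
  funext a i j
  simpa using congrFun (congrFun (congrFun key a) (e.symm i)) (e.symm j)

theorem alternating_eq_zero_of_twisted_relation {K T I J : Type*} [Field K] {σ : T → T}
    (hσ : Function.Surjective σ) {w₀ : T → K} {w : J → T → K}
    (hw₀ : ∀ l a, w l a * w₀ (σ a) - w₀ a * w l (σ a) ≠ 0)
    (hw : ∀ l j a, l ≠ j → w l a * w j (σ a) - w j a * w l (σ a) ≠ 0)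
    {A : T → I → I → K} (halt : ∀ a i, A a i i = 0) (hskew : ∀ a i j, A a i j = -A a j i)
    {e₀ : I} {e f : J → I}
    (h : ∀ l a x, A (σ a) (f l) x = w l a * A a (e l) x - w₀ a * A a e₀ x) :
    (∀ a l, A a e₀ (e l) = 0) ∧ (∀ a l j, A a (e l) (e j) = 0) ∧ (∀ a l, A a (f l) e₀ = 0) ∧
      (∀ a l j, A a (f l) (e j) = 0) ∧ (∀ a l j, A a (f l) (f j) = 0) := by
  have hff : ∀ a j k, A (σ (σ a)) (f j) (f k) =
      -(w j (σ a) * (w k a * A a (e k) (e j) - w₀ a * A a e₀ (e j)))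
        + w₀ (σ a) * (w k a * A a (e k) e₀) := by
    intro a j k
    rw [h, hskew _ (e j), hskew _ e₀, h, h, halt _ e₀]
    ring
  have h1 : ∀ a l, A a e₀ (e l) = 0 := by
    intro a l
    have h0 := hff a l l
    rw [halt, halt, hskew a (e l) e₀] at h0
    have : (w l a * w₀ (σ a) - w₀ a * w l (σ a)) * A a e₀ (e l) = 0 := by
      linear_combination h0
    exact (mul_eq_zero.mp this).resolve_left (hw₀ l a)
  have h1' : ∀ a l, A a (e l) e₀ = 0 := fun a l => by rw [hskew, h1, neg_zero]
  have h2 : ∀ a l j, A a (e l) (e j) = 0 := by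
    intro a l j
    by_cases hlj : l = j
    · rw [hlj, halt]
    · have e1 := hff a l j
      have e2 := hff a j l
      rw [hskew, e2, hskew a (e j) (e l), h1, h1, h1', h1'] at e1
      have : (w l a * w j (σ a) - w j a * w l (σ a)) * A a (e l) (e j) = 0 := by
        linear_combination e1
      exact (mul_eq_zero.mp this).resolve_left (hw l j a hlj)
  have h3 : ∀ a l, A a (f l) e₀ = 0 := by
    intro a l
    obtain ⟨a, rfl⟩ := hσ a
    rw [h, halt, h1']; ring
  have h4 : ∀ a l j, A a (f l) (e j) = 0 := by
    intro a l j
    obtain ⟨a, rfl⟩ := hσ a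
    rw [h, h2, h1]; ring
  refine ⟨h1, h2, h3, h4, ?_⟩
  intro a l j
  obtain ⟨a, rfl⟩ := hσ a
  rw [h, hskew a (e l), hskew a e₀, h3, h4]; ring

theorem exists_twisting_weights (K : Type*) [Field K] [IsAlgClosed K] (t : ℕ) :
    ∃ w : ℕ → Fin (t + 2) → K, (∀ l a, w l a ≠ 0) ∧
      ∀ l j a, l ≠ j → w l a * w j (a + 1) - w j a * w l (a + 1) ≠ 0 := by
  have hinf : Infinite ({0}ᶜ : Set K) := (Set.finite_singleton (0 : K)).infinite_compl.to_subtype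
  let g : ℕ ↪ ({0}ᶜ : Set K) := Infinite.natEmbedding _
  choose μ hμ using fun l => IsAlgClosed.exists_pow_nat_eq (g l : K) (Nat.succ_pos t)
  have hμ0 : ∀ l, μ l ≠ 0 := fun l h0 => by
    have := hμ l
    rw [h0, zero_pow (by lia)] at this
    exact (g l).2 this.symm
  have hne : ∀ l j, l ≠ j → μ l ^ (t + 1) ≠ μ j ^ (t + 1) := fun l j hlj h => by
    rw [hμ, hμ] at h
    exact hlj (g.injective (Subtype.ext h))
  refine ⟨fun l a => μ l ^ a.val, fun l a => pow_ne_zero _ (hμ0 l), fun l j a hlj => ?_⟩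
  have hv := Fin.val_add_one a
  dsimp only
  by_cases ha : a = Fin.last _
  · rw [if_pos ha] at hv
    rw [hv, ha]
    simpa [sub_eq_zero] using hne l j hlj
  · rw [if_neg ha] at hv
    rw [hv, pow_succ, pow_succ]
    have : μ l ^ a.val * (μ j ^ a.val * μ j) - μ j ^ a.val * (μ l ^ a.val * μ l)
        = μ l ^ a.val * μ j ^ a.val * (μ j - μ l) := by ring
    rw [this]
    refine mul_ne_zero (mul_ne_zero (pow_ne_zero _ (hμ0 l)) (pow_ne_zero _ (hμ0 j))) ?_
    intro h
    rw [sub_eq_zero] at h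
    exact hne l j hlj (by rw [h])

/-- The coefficients of the relations
`A (a + 1) (f l) x = w (l + 1) a * A a (e l) x - w 0 a * A a e₀ x`. -/
def twistedCoeff {K I : Type*} [Field K] [DecidableEq I] {t k : ℕ} (w : ℕ → Fin (t + 2) → K)
    (e₀ : I) (e f : Fin k → I) (b : Fin (t + 2)) (c : Fin k × Fin (t + 2)) (i : I) : K :=
  (if b = c.2 + 1 then if i = f c.1 then 1 else 0 else 0)
    - (if b = c.2 then if i = e c.1 then w (c.1 + 1) b else 0 else 0)
    + (if b = c.2 then if i = e₀ then w 0 b else 0 else 0)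

theorem sum_twistedCoeff_mul {K I : Type*} [Field K] [Fintype I] [DecidableEq I] {t k : ℕ}
    (w : ℕ → Fin (t + 2) → K) (e₀ : I) (e f : Fin k → I) (A : Fin (t + 2) → I → I → K)
    (c : Fin k × Fin (t + 2)) (x : I) :
    ∑ b, ∑ i, twistedCoeff w e₀ e f b c i * A b i x =
      A (c.2 + 1) (f c.1) x - w (c.1 + 1) c.2 * A c.2 (e c.1) x + w 0 c.2 * A c.2 e₀ x := by
  simp only [twistedCoeff, add_mul, sub_mul, Finset.sum_add_distrib, Finset.sum_sub_distrib,
    ite_mul, zero_mul, one_mul]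
  congr 1
  · congr 1
    · rw [Finset.sum_eq_single (c.2 + 1) (fun b _ hb => by simp [hb]) (by simp)]
      simp
    · rw [Finset.sum_eq_single c.2 (fun b _ hb => by simp [hb]) (by simp)]
      simp
  · rw [Finset.sum_eq_single c.2 (fun b _ hb => by simp [hb]) (by simp)]
    simp

theorem exists_nondegeneratePairing_odd (K : Type*) [Field K] [IsAlgClosed K] (t k : ℕ) :
    ∃ B : Fin (t + 2) → Fin k × Fin (t + 2) → Unit ⊕ Fin k ⊕ Fin k → K,
      IsNondegeneratePairing B := by
  classical
  obtain ⟨w, -, hw⟩ := exists_twisting_weights K t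
  refine ⟨twistedCoeff w (.inl ()) (fun l => .inr (.inl l)) (fun l => .inr (.inr l)), ?_⟩
  intro A halt hskew hrel
  obtain ⟨h1, h2, h3, h4, h5⟩ := alternating_eq_zero_of_twisted_relation
    (σ := fun a : Fin (t + 2) => a + 1) (add_right_surjective 1) (w₀ := w 0)
    (w := fun l : Fin k => w (l + 1))
    (fun l a => hw _ _ a (by lia)) (fun l j a hlj => hw _ _ a (by simpa [Fin.ext_iff] using hlj))
    halt hskew (e₀ := Sum.inl ()) (e := fun l => .inr (.inl l)) (f := fun l => .inr (.inr l))
    (fun l a x => by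
      have := hrel (l, a) x
      rw [sum_twistedCoeff_mul] at this
      linear_combination this)
  funext a i j
  rcases i with ⟨⟩ | i | i <;> rcases j with ⟨⟩ | j | j <;>
    first
    | simp [halt, h1, h2, h3, h4, h5]; done
    | rw [hskew]; simp [h1, h3, h4]

theorem exists_nondegeneratePairing_even (K : Type*) [Field K] [IsAlgClosed K] (t k : ℕ) :
    ∃ B : Fin (t + 2) → (Fin k × Fin (t + 2)) ⊕ Fin ((t + 3) / 2) →
      Option (Unit ⊕ Fin k ⊕ Fin k) → K, IsNondegeneratePairing B := by
  classical
  obtain ⟨w, hw0, hw⟩ := exists_twisting_weights K t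
  let e₀ : Option (Unit ⊕ Fin k ⊕ Fin k) := some (.inl ())
  let e : Fin k → Option (Unit ⊕ Fin k ⊕ Fin k) := fun l => some (.inr (.inl l))
  let f : Fin k → Option (Unit ⊕ Fin k ⊕ Fin k) := fun l => some (.inr (.inr l))
  refine ⟨fun b => Sum.elim (twistedCoeff w e₀ e f b) (fun c i =>
    (if b.val = 2 * c.val then if i = none then 1 else 0 else 0)
      + (if b.val = 2 * c.val + 1 then if i = e₀ then 1 else 0 else 0)), ?_⟩
  intro A halt hskew hrel
  have hE : ∀ l a x, A (a + 1) (f l) x = w (l + 1) a * A a (e l) x - w 0 a * A a e₀ x :=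
    fun l a x => by
      have := hrel (.inl (l, a)) x
      simp only [Sum.elim_inl] at this
      rw [sum_twistedCoeff_mul] at this
      linear_combination this
  obtain ⟨h1, h2, h3, h4, h5⟩ := alternating_eq_zero_of_twisted_relation
    (σ := fun a : Fin (t + 2) => a + 1) (add_right_surjective 1) (w₀ := w 0)
    (w := fun l : Fin k => w (l + 1))
    (fun l a => hw _ _ a (by lia)) (fun l j a hlj => hw _ _ a (by simpa [Fin.ext_iff] using hlj))
    halt hskew hE
  have hG : ∀ (c : Fin ((t + 3) / 2)) x,
      ∑ b : Fin (t + 2), ((if b.val = 2 * c.val then A b none x else 0)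
        + (if b.val = 2 * c.val + 1 then A b e₀ x else 0)) = 0 := by
    intro c x
    have := hrel (.inr c) x
    simp only [Sum.elim_inr] at this
    refine Eq.trans (Finset.sum_congr rfl fun b _ => ?_) this
    simp only [add_mul, Finset.sum_add_distrib, ite_mul, zero_mul, one_mul]
    congr 1
    · split_ifs <;> simp
    · split_ifs <;> simp
  have hEv : ∀ a x, Even a.val → (∀ b, A b e₀ x = 0) → A a none x = 0 := by
    intro a x ha hx
    obtain ⟨r, hr⟩ := ha
    have := hG ⟨r, by lia⟩ x
    simp only [hx, ite_self, add_zero] at this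
    rw [Finset.sum_eq_single a (fun b _ hb => if_neg fun h => hb (Fin.ext (by lia)))
      (by simp)] at this
    simpa [show a.val = 2 * r by lia] using this
  have hz : ∀ a, A a e₀ none = 0 := by
    intro a
    rcases Nat.even_or_odd a.val with ha | ha
    · rw [hskew, hEv a e₀ ha fun b => halt _ _, neg_zero]
    · obtain ⟨r, hr⟩ := ha
      have := hG ⟨r, by lia⟩ none
      simp only [halt, ite_self, zero_add] at this
      rw [Finset.sum_eq_single a (fun b _ hb => if_neg fun h => hb (Fin.ext (by lia)))
        (by simp)] at this
      simpa [hr] using this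
  have he0 : ∀ a l, Even a.val → A a (e l) none = 0 := fun a l ha => by
    rw [hskew, hEv a _ ha fun b => h1 b l, neg_zero]
  have hf0 : ∀ a l, Even a.val → A a (f l) none = 0 := fun a l ha => by
    rw [hskew, hEv a _ ha fun b => by rw [hskew, h3, neg_zero], neg_zero]
  have he : ∀ a l, A a (e l) none = 0 := by
    intro a l
    rcases Nat.even_or_odd a.val with ha | ha
    · exact he0 a l ha
    · have h := hE l a none
      have hev : Even (a + 1).val := by
        rw [Fin.val_add_one]
        split_ifs
        · exact Even.zero
        · exact ha.add_one
      rw [hf0 _ _ hev, hz, mul_zero, sub_zero] at h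
      exact (mul_eq_zero.mp h.symm).resolve_left (hw0 _ _)
  have hf : ∀ a l, A a (f l) none = 0 := by
    intro a l
    obtain ⟨a, rfl⟩ := add_right_surjective (1 : Fin (t + 2)) a
    dsimp only
    rw [hE, he, hz]; ring
  have hz' : ∀ a, A a none e₀ = 0 := fun a => by rw [hskew, hz, neg_zero]
  have he' : ∀ a l, A a none (e l) = 0 := fun a l => by rw [hskew, he, neg_zero]
  have hf' : ∀ a l, A a none (f l) = 0 := fun a l => by rw [hskew, hf, neg_zero]
  have h1' : ∀ a l, A a (e l) e₀ = 0 := fun a l => by rw [hskew, h1, neg_zero]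
  have h3' : ∀ a l, A a e₀ (f l) = 0 := fun a l => by rw [hskew, h3, neg_zero]
  have h4' : ∀ a l j, A a (e l) (f j) = 0 := fun a l j => by rw [hskew, h4, neg_zero]
  funext a i j
  rcases i with _ | ⟨⟨⟩⟩ | i | i <;> rcases j with _ | ⟨⟨⟩⟩ | j | j <;>
    first
    | exact halt _ _
    | exact hz _
    | exact hz' _
    | exact he _ _
    | exact he' _ _
    | exact hf _ _
    | exact hf' _ _
    | exact h1 _ _
    | exact h1' _ _
    | exact h2 _ _ _
    | exact h3 _ _
    | exact h3' _ _
    | exact h4 _ _ _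
    | exact h4' _ _ _
    | exact h5 _ _ _

theorem exists_nondegeneratePairing (K : Type*) [Field K] [IsAlgClosed K] {t m p : ℕ}
    (ht : 2 ≤ t) (h : t * (m - 1) ≤ 2 * p) :
    ∃ B : Fin t → Fin p → Fin m → K, IsNondegeneratePairing B := by
  obtain ⟨t, rfl⟩ := Nat.exists_eq_add_of_le' ht
  obtain ⟨k, rfl | rfl⟩ := Nat.even_or_odd' m
  · obtain rfl | ⟨k, rfl⟩ : k = 0 ∨ ∃ l, k = l + 1 :=
      k.eq_zero_or_eq_succ_pred.imp id fun h => ⟨_, h⟩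
    · refine ⟨fun _ _ _ => 0, fun A _ _ _ => ?_⟩
      funext a i
      exact i.elim0
    · obtain ⟨B, hB⟩ := exists_nondegeneratePairing_even K t k
      refine hB.exists_fin (by simp; ring) ?_
      simp only [Fintype.card_sum, Fintype.card_prod, Fintype.card_fin]
      have e1 : 2 * (k + 1) - 1 = 2 * k + 1 := by lia
      rw [e1] at h
      have e2 : (t + 2) * (2 * k + 1) = 2 * (k * (t + 2)) + (t + 2) := by ring
      lia
  · obtain ⟨B, hB⟩ := exists_nondegeneratePairing_odd K t k
    refine hB.exists_fin (by simp; ring) ?_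
    simp only [Fintype.card_prod, Fintype.card_fin]
    have e2 : (t + 2) * (2 * k + 1 - 1) = 2 * (k * (t + 2)) := by
      rw [Nat.add_sub_cancel]; ring
    lia

theorem sum_symm_mul_alternating_eq_zero {R N : Type*} [CommRing R] [Fintype N] {s w : N → N → R}
    (hs : ∀ i j, s i j = s j i) (halt : ∀ i, w i i = 0) (hskew : ∀ i j, w i j = -w j i) :
    ∑ i, ∑ j, s i j * w i j = 0 := by
  rw [← Fintype.sum_prod_type' (f := fun i j => s i j * w i j)]
  refine Finset.sum_involution (fun x _ => (x.2, x.1)) ?_ ?_ (by simp) (by simp)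
  · intro x _
    simp only
    rw [hs x.1 x.2, hskew x.1 x.2]
    ring
  · rintro ⟨i, j⟩ _ h hij
    obtain rfl : j = i := (Prod.ext_iff.mp hij).1
    exact h (by simp [halt])

theorem IsNondegeneratePairing.exists_eq {K T C I : Type*} [Field K] [Fintype T] [Fintype I]
    [Fintype C] {B : T → C → I → K} (hB : IsNondegeneratePairing B) {x : T → I → I → K}
    (halt : ∀ a i, x a i i = 0) (hskew : ∀ a i j, x a i j = -x a j i) :
    ∃ φ : I → C → K, ∀ a i j, ∑ c, (φ j c * B a c i - φ i c * B a c j) = x a i j := by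
  classical
  let D : (I → C → K) →ₗ[K] (T × I × I → K) :=
    { toFun := fun φ q => ∑ c, (φ q.2.2 c * B q.1 c q.2.1 - φ q.2.1 c * B q.1 c q.2.2)
      map_add' := fun φ ψ => by
        funext q
        simp only [Pi.add_apply, ← Finset.sum_add_distrib]
        exact Finset.sum_congr rfl fun c _ => by ring
      map_smul' := fun r φ => by
        funext q
        simp only [Pi.smul_apply, smul_eq_mul, Finset.mul_sum, RingHom.id_apply]
        exact Finset.sum_congr rfl fun c _ => by ring }
  let x' : T × I × I → K := fun q => x q.1 q.2.1 q.2.2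
  suffices h : x' ∈ LinearMap.range D by
    obtain ⟨φ, hφ⟩ := h
    exact ⟨φ, fun a i j => congrFun hφ (a, i, j)⟩
  by_contra hx
  obtain ⟨f, hfx, hf⟩ := Submodule.exists_le_ker_of_notMem hx
  refine hfx ?_
  let c : T → I → I → K := fun a i j => f fun q => if (a, i, j) = q then 1 else 0
  have hfc : ∀ y : T × I × I → K, f y = ∑ a, ∑ i, ∑ j, c a i j * y (a, i, j) := by
    intro y
    rw [LinearMap.pi_apply_eq_sum_univ f y, Fintype.sum_prod_type]
    refine Finset.sum_congr rfl fun a _ => ?_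
    rw [Fintype.sum_prod_type]
    refine Finset.sum_congr rfl fun i _ => Finset.sum_congr rfl fun j _ => ?_
    rw [smul_eq_mul, mul_comm]
  have hsymm := hB (fun a i j => c a i j - c a j i) (fun a i => sub_self _)
    (fun a i j => by ring) (by
      intro k j
      have h0 : f (D (Pi.single j (Pi.single k 1))) = 0 := hf ⟨_, rfl⟩
      rw [hfc] at h0
      rw [← h0]
      refine Finset.sum_congr rfl fun a _ => ?_
      have hD : ∀ i l, D (Pi.single j (Pi.single k 1)) (a, i, l) =
          (if l = j then B a k i else 0) - (if i = j then B a k l else 0) := by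
        intro i l
        simp only [D, LinearMap.coe_mk, AddHom.coe_mk, Finset.sum_sub_distrib]
        congr 1
        · rw [Finset.sum_eq_single k (fun b _ hb => by
            by_cases h : l = j
            · subst h; simp [hb]
            · simp [h]) (by simp)]
          by_cases h : l = j
          · subst h; simp
          · simp [h]
        · rw [Finset.sum_eq_single k (fun b _ hb => by
            by_cases h : i = j
            · subst h; simp [hb]
            · simp [h]) (by simp)]
          by_cases h : i = j
          · subst h; simp
          · simp [h]
      simp only [hD, mul_sub, Finset.sum_sub_distrib, mul_ite, mul_zero, Finset.sum_ite_eq',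
        Finset.mem_univ, if_true]
      congr 1
      · exact Finset.sum_congr rfl fun i _ => mul_comm _ _
      · rw [Finset.sum_comm]
        simp [mul_comm])
  rw [hfc]
  refine Finset.sum_eq_zero fun a _ => ?_
  refine sum_symm_mul_alternating_eq_zero (fun i j => ?_) (halt a) (hskew a)
  exact sub_eq_zero.mp (congrFun (congrFun (congrFun hsymm a) i) j)

theorem exists_strongRec {E : Type*} [Inhabited E] (F : ℕ → (ℕ → E) → E)
    (hF : ∀ n g g', (∀ l < n, g l = g' l) → F n g = F n g') : ∃ ψ : ℕ → E, ∀ n, ψ n = F n ψ := by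
  let ψ : ℕ → E := Nat.lt_wfRel.wf.fix fun n ih =>
    F n fun l => if h : l < n then ih l h else default
  refine ⟨ψ, fun n => ?_⟩
  have h := Nat.lt_wfRel.wf.fix_eq (C := fun _ => E) (fun n ih =>
    F n fun l => if h : l < n then ih l h else default) n
  refine h.trans (hF _ _ _ fun l hl => ?_)
  rw [dif_pos hl]

/-- The value of the bilinear form with matrix `w` on the rows `i` and `j` of `Y`. -/
def formOnRows {R I N : Type*} [CommRing R] [Fintype N] (w : N → N → R) (Y : I → N → R)
    (i j : I) : R :=
  ∑ k, ∑ l, Y i k * Y j l * w k l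

theorem formOnRows_self {R I N : Type*} [CommRing R] [Fintype N] {w : N → N → R}
    (halt : ∀ k, w k k = 0) (hskew : ∀ k l, w k l = -w l k) (Y : I → N → R) (i : I) :
    formOnRows w Y i i = 0 :=
  sum_symm_mul_alternating_eq_zero (fun _ _ => mul_comm _ _) halt hskew

theorem formOnRows_skew {R I N : Type*} [CommRing R] [Fintype N] {w : N → N → R}
    (hskew : ∀ k l, w k l = -w l k) (Y : I → N → R) (i j : I) :
    formOnRows w Y i j = -formOnRows w Y j i := by
  rw [formOnRows, formOnRows, Finset.sum_comm, ← Finset.sum_neg_distrib]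
  refine Finset.sum_congr rfl fun k _ => ?_
  rw [← Finset.sum_neg_distrib]
  refine Finset.sum_congr rfl fun l _ => ?_
  rw [hskew l k]
  ring

theorem map_formOnRows {R S I N : Type*} [CommRing R] [CommRing S] [Fintype N] (g : R →+* S)
    (w : N → N → R) (Y : I → N → R) (i j : I) :
    g (formOnRows w Y i j) = formOnRows (fun k l => g (w k l)) (fun i k => g (Y i k)) i j := by
  simp [formOnRows]

/-- The rows spanning the graph of the linear map with matrix `φ`. -/
def graphRows {R I C : Type*} [CommRing R] [DecidableEq I] (φ : I → C → R) (i : I) :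
    I ⊕ C → R :=
  Sum.elim (Pi.single i 1) (φ i)

/-- The alternating form that vanishes on both summands and pairs them through `b`. -/
def hyperbolicForm {R I C : Type*} [CommRing R] (b : C → I → R) : I ⊕ C → I ⊕ C → R
  | .inl i, .inr c => b c i
  | .inr c, .inl i => -b c i
  | _, _ => 0

theorem formOnRows_hyperbolicForm {R I C : Type*} [CommRing R] [Fintype I] [Fintype C]
    [DecidableEq I] (b : C → I → R) (φ : I → C → R) (i j : I) :
    formOnRows (hyperbolicForm b) (graphRows φ) i j = ∑ c, (φ j c * b c i - φ i c * b c j) := by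
  simp only [formOnRows, graphRows, Fintype.sum_sum_type, Sum.elim_inl, Sum.elim_inr,
    hyperbolicForm, sub_eq_add_neg, Finset.sum_add_distrib, mul_zero, Finset.sum_const_zero,
    zero_add, add_zero]
  rw [add_comm]
  congr 1
  · rw [Finset.sum_eq_single i (fun k _ hk => by simp [hk]) (by simp)]
    simp
  · refine Finset.sum_congr rfl fun c _ => ?_
    rw [Finset.sum_eq_single j (fun k _ hk => by simp [hk]) (by simp)]
    simp

open PowerSeries in
theorem coeff_formOnRows_graphRows_congr {K I C : Type*} [Field K] [Fintype I] [Fintype C]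
    [DecidableEq I] (w : I ⊕ C → I ⊕ C → K⟦X⟧) {φ ψ : I → C → K⟦X⟧} {n : ℕ}
    (h : ∀ i c, ∀ l < n + 1, coeff l (φ i c) = coeff l (ψ i c)) (i j : I) :
    coeff n (formOnRows w (graphRows φ) i j) = coeff n (formOnRows w (graphRows ψ) i j) := by
  have hd : ∀ i k, (X : K⟦X⟧) ^ (n + 1) ∣ graphRows φ i k - graphRows ψ i k := by
    intro i k
    rcases k with k | c
    · simp [graphRows]
    · rw [X_pow_dvd_iff]
      intro l hl
      simp [graphRows, h i c l hl]
  have key : (X : K⟦X⟧) ^ (n + 1) ∣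
      formOnRows w (graphRows φ) i j - formOnRows w (graphRows ψ) i j := by
    simp only [formOnRows, ← Finset.sum_sub_distrib]
    refine Finset.dvd_sum fun k _ => Finset.dvd_sum fun l _ => ?_
    rw [← sub_mul]
    exact Dvd.dvd.mul_right (dvd_mul_sub_mul (hd i k) (hd j l)) _
  rw [X_pow_dvd_iff] at key
  simpa [sub_eq_zero] using key n (Nat.lt_succ_self n)

open PowerSeries in
theorem IsNondegeneratePairing.exists_powerSeries {K T C I : Type*} [Field K] [Fintype T]
    [Fintype I] [Fintype C] [DecidableEq I] {B : T → C → I → K} (hB : IsNondegeneratePairing B)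
    {w : T → I ⊕ C → I ⊕ C → K} (halt : ∀ a k, w a k k = 0)
    (hskew : ∀ a k l, w a k l = -w a l k) :
    ∃ φ : I → C → K⟦X⟧, ∀ a i j,
      formOnRows (fun k l => PowerSeries.C (hyperbolicForm (B a) k l) + X * PowerSeries.C (w a k l))
        (graphRows φ) i j = 0 := by
  choose! r hr using fun (x : T → I → I → K)
    (hx : (∀ a i, x a i i = 0) ∧ ∀ a i j, x a i j = -x a j i) => hB.exists_eq hx.1 hx.2
  let W : T → I ⊕ C → I ⊕ C → K⟦X⟧ := fun a k l => PowerSeries.C (w a k l)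
  let s : (ℕ → I → C → K) → I → C → K⟦X⟧ := fun g i c => mk fun l => g l i c
  let F : ℕ → (ℕ → I → C → K) → I → C → K := fun n g =>
    n.casesOn 0 fun n => r fun a i j => -coeff n (formOnRows (W a) (graphRows (s g)) i j)
  have : Inhabited (I → C → K) := ⟨0⟩
  obtain ⟨ψ, hψ⟩ := exists_strongRec F (by
    intro n g g' h
    rcases n with _ | n
    · rfl
    · simp only [F]
      congr 1
      funext a i j
      rw [coeff_formOnRows_graphRows_congr]
      intro i c l hl
      simp [s, h l hl])
  refine ⟨s ψ, fun a i j => ?_⟩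
  have hsplit : formOnRows (fun k l => PowerSeries.C (hyperbolicForm (B a) k l)
        + X * PowerSeries.C (w a k l)) (graphRows (s ψ)) i j =
      formOnRows (hyperbolicForm fun c i => PowerSeries.C (B a c i)) (graphRows (s ψ)) i j
        + X * formOnRows (W a) (graphRows (s ψ)) i j := by
    simp only [formOnRows, Finset.mul_sum, ← Finset.sum_add_distrib]
    refine Finset.sum_congr rfl fun k _ => Finset.sum_congr rfl fun l _ => ?_
    have : PowerSeries.C (hyperbolicForm (B a) k l) =
        hyperbolicForm (fun c i => PowerSeries.C (B a c i)) k l := by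
      rcases k with k | k <;> rcases l with l | l <;> simp [hyperbolicForm]
    rw [this]
    ring
  rw [hsplit, formOnRows_hyperbolicForm]
  ext n
  have hD : coeff n (∑ c, (s ψ j c * PowerSeries.C (B a c i) - s ψ i c * PowerSeries.C (B a c j)))
      = ∑ c, (ψ n j c * B a c i - ψ n i c * B a c j) := by
    simp [s, coeff_mul_C]
  rw [map_add, hD, map_zero]
  rcases n with _ | n
  · have h0 : ψ 0 = 0 := hψ 0
    simp [h0]
  · rw [coeff_succ_X_mul, hψ (n + 1)]
    simp only [F]
    rw [hr]
    · ring
    · have hW : ∀ a k l, W a k l = -W a l k := fun a k l => by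
        simp only [W]
        rw [hskew, map_neg]
      refine ⟨fun a i => ?_, fun a i j => ?_⟩
      · rw [formOnRows_self (fun k => by simp [W, halt]) (hW a), map_zero, neg_zero]
      · rw [formOnRows_skew (hW a), map_neg]

theorem IsAlgClosed.nonempty_algHom_of_finiteType (K S : Type*) [Field K] [IsAlgClosed K]
    [CommRing S] [Nontrivial S] [Algebra K S] [Algebra.FiniteType K S] : Nonempty (S →ₐ[K] K) := by
  obtain ⟨M, hM⟩ := Ideal.exists_maximal S
  let _ : Field (S ⧸ M) := Ideal.Quotient.field M
  have : Module.Finite K (S ⧸ M) := finite_of_finite_type_of_isJacobsonRing K (S ⧸ M)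
  have hbij := IsAlgClosed.algebraMap_bijective_of_isIntegral (k := K) (K := S ⧸ M)
  exact ⟨((AlgEquiv.ofBijective (Algebra.ofId K (S ⧸ M)) hbij).symm : (S ⧸ M) →ₐ[K] K).comp
    (Ideal.Quotient.mkₐ K M)⟩

theorem exists_formOnRows_eq_zero_of_extension {K k T I N : Type*} [Field K] [IsAlgClosed K]
    [Field k] [Finite I] [Fintype N] [DecidableEq I] (g : K →+* k) (w : T → N → N → K)
    (f : I → N) {Z : I → N → k} (hZ : ∀ i j, Z i (f j) = if i = j then 1 else 0)
    (hw : ∀ a i j, formOnRows (fun k l => g (w a k l)) Z i j = 0) :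
    ∃ Y : I → N → K, (∀ i j, Y i (f j) = if i = j then 1 else 0) ∧
      ∀ a i j, formOnRows (w a) Y i j = 0 := by
  let _ : Algebra K k := g.toAlgebra
  let S := Algebra.adjoin K (Set.range fun q : I × N => Z q.1 q.2)
  have hfin : Algebra.FiniteType K S :=
    (Subalgebra.fg_iff_finiteType S).mp (Subalgebra.fg_def.mpr ⟨_, Set.finite_range _, rfl⟩)
  obtain ⟨ψ⟩ := IsAlgClosed.nonempty_algHom_of_finiteType K S
  let ZS : I → N → S := fun i l => ⟨Z i l, Algebra.subset_adjoin ⟨(i, l), rfl⟩⟩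
  refine ⟨fun i l => ψ (ZS i l), fun i j => ?_, fun a i j => ?_⟩
  · have : ZS i (f j) = if i = j then 1 else 0 := by
      apply Subtype.ext
      simp only [ZS, hZ]
      split_ifs <;> rfl
    dsimp only
    rw [this]
    split_ifs <;> simp
  · have h0 : formOnRows (fun k l => algebraMap K S (w a k l)) ZS i j = 0 := by
      apply Subtype.val_injective
      exact (map_formOnRows S.val.toRingHom _ ZS i j).trans (hw a i j)
    have h1 := map_formOnRows ψ.toRingHom (fun k l => algebraMap K S (w a k l)) ZS i j
    rw [h0, map_zero] at h1
    rw [h1]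
    congr 1
    funext k l
    exact (ψ.commutes _).symm

theorem ValuationSubring.exists_rows_with_identity_block {Ω I N : Type*} [Field Ω] [Fintype I]
    [Finite N] [DecidableEq I] (V : ValuationSubring Ω) (Y : Matrix I N Ω) {f₀ : I → N}
    (hf₀ : (Y.submatrix id f₀).det ≠ 0) :
    ∃ (f : I → N) (P : Matrix I I Ω), (∀ i k, (P * Y) i k ∈ V) ∧
      ∀ i j, (P * Y) i (f j) = if i = j then 1 else 0 := by
  classical
  have : Nonempty (I → N) := ⟨f₀⟩
  obtain ⟨f, hf⟩ := Finite.exists_max fun f : I → N => V.valuation (Y.submatrix id f).det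
  have hdet : (Y.submatrix id f).det ≠ 0 := by
    intro h
    have := hf f₀
    rw [h, map_zero] at this
    exact hf₀ ((map_eq_zero _).mp (le_antisymm this zero_le))
  refine ⟨f, (Y.submatrix id f)⁻¹, fun i k => ?_, fun i j => ?_⟩
  · have hcr : ((Y.submatrix id f)⁻¹ * Y) i k =
        (Y.submatrix id f).det⁻¹ * (Y.submatrix id (Function.update f i k)).det := by
      have h1 : Y.submatrix id (Function.update f i k) =
          (Y.submatrix id f).updateCol i (fun l => Y l k) := by
        ext a b
        by_cases hb : b = i
        · subst hb; simp
        · simp [hb]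
      rw [h1, ← Matrix.cramer_apply, Matrix.cramer_eq_adjugate_mulVec, Matrix.inv_def,
        Ring.inverse_eq_inv', Matrix.smul_mul]
      rfl
    rw [hcr, ← V.valuation_le_one_iff, map_mul, map_inv₀]
    exact inv_mul_le_one_of_le₀ (hf _) zero_le
  · have h1 : (Y.submatrix id f)⁻¹ * Y.submatrix id f = 1 :=
      Matrix.nonsing_inv_mul _ (isUnit_iff_ne_zero.mpr hdet)
    have h2 := congrFun (congrFun h1 i) j
    rw [Matrix.one_apply] at h2
    exact h2

theorem formOnRows_mul_eq_zero {R I N : Type*} [CommRing R] [Fintype I] [Fintype N]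
    {w : N → N → R} {Y : Matrix I N R} (P : Matrix I I R) (h : ∀ i j, formOnRows w Y i j = 0)
    (i j : I) : formOnRows w (P * Y) i j = 0 := by
  have e : formOnRows w (P * Y) i j = ∑ a, ∑ b, P i a * P j b * formOnRows w Y a b := by
    simp only [formOnRows, Matrix.mul_apply, Finset.sum_mul, Finset.mul_sum]
    conv_rhs => rw [Finset.sum_comm]
    rw [Finset.sum_congr rfl fun k _ => Finset.sum_comm]
    rw [Finset.sum_comm]
    refine Finset.sum_congr rfl fun a _ => ?_
    rw [Finset.sum_congr rfl fun k _ => Finset.sum_comm]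
    rw [Finset.sum_comm]
    refine Finset.sum_congr rfl fun b _ => Finset.sum_congr rfl fun k _ =>
      Finset.sum_congr rfl fun l _ => ?_
    ring
  rw [e]
  simp [h]

open PowerSeries in
theorem PowerSeries.transcendental_X (K : Type*) [Field K] : Transcendental K (X : K⟦X⟧) := by
  rw [transcendental_iff_injective]
  have h : (Polynomial.aeval (X : K⟦X⟧) : Polynomial K →ₐ[K] K⟦X⟧) =
      Polynomial.coeToPowerSeries.algHom K := by
    apply Polynomial.algHom_ext
    simp [Polynomial.coeToPowerSeries.algHom_apply]
  rw [h]
  intro p q hpq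
  simpa [Polynomial.coeToPowerSeries.algHom_apply] using hpq

theorem exists_valuationSubring_of_transcendental {K Ω : Type*} [Field K] [Field Ω] [Algebra K Ω]
    {u : Ω} (hu : Transcendental K u) :
    ∃ V : ValuationSubring Ω, (∀ x : K, algebraMap K Ω x ∈ V) ∧ u ∈ V.nonunits := by
  let g : Polynomial K →+* Ω := (Polynomial.aeval u : Polynomial K →ₐ[K] Ω).toRingHom
  have hmem : ∀ p, g p ∈ g.range := fun p => ⟨p, rfl⟩
  let I : Ideal g.range := Ideal.span {⟨g Polynomial.X, hmem _⟩}
  have hI : I ≠ ⊤ := by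
    rw [Ne, Ideal.eq_top_iff_one, Ideal.mem_span_singleton]
    rintro ⟨⟨_, q, rfl⟩, hq⟩
    have h1 : g 1 = g (Polynomial.X * q) := by
      rw [map_one, map_mul]
      exact congrArg Subtype.val hq
    have h2 : (1 : Polynomial K) = Polynomial.X * q :=
      transcendental_iff_injective.mp hu h1
    have := congrArg (Polynomial.eval 0) h2
    simp at this
  obtain ⟨V, hV, hVI⟩ := Ideal.image_subset_nonunits_valuationSubring I hI
  refine ⟨V, fun x => hV ⟨Polynomial.C x, ?_⟩, hVI ⟨_, Ideal.subset_span rfl, ?_⟩⟩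
  · exact Polynomial.aeval_C u x
  · exact Polynomial.aeval_X u

theorem exists_formOnRows_eq_zero_of_pencil {K Ω T I N : Type*} [Field K] [IsAlgClosed K]
    [Field Ω] [Algebra K Ω] [Fintype I] [Fintype N] [DecidableEq I] {s : Ω}
    (hs : Transcendental K s) (w₀ w : T → N → N → K) {Y : Matrix I N Ω} {f₀ : I → N}
    (hdet : (Y.submatrix id f₀).det ≠ 0)
    (hY : ∀ a i j, formOnRows
      (fun k l => algebraMap K Ω (w₀ a k l) + s * algebraMap K Ω (w a k l)) Y i j = 0) :
    ∃ (f : I → N) (Z : I → N → K), (∀ i j, Z i (f j) = if i = j then 1 else 0) ∧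
      ∀ a i j, formOnRows (w a) Z i j = 0 := by
  have hs0 : s ≠ 0 := fun h => hs (h ▸ isAlgebraic_zero)
  have hu : Transcendental K s⁻¹ := fun h => hs (IsAlgebraic.inv_iff.mp h)
  obtain ⟨V, hVK, hVu⟩ := exists_valuationSubring_of_transcendental hu
  let wΩ : T → N → N → Ω := fun a k l =>
    s⁻¹ * algebraMap K Ω (w₀ a k l) + algebraMap K Ω (w a k l)
  have hY' : ∀ a i j, formOnRows (wΩ a) Y i j = 0 := by
    intro a i j
    have h2 : s * formOnRows (wΩ a) Y i j = 0 := by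
      rw [← hY a i j]
      simp only [formOnRows, Finset.mul_sum]
      refine Finset.sum_congr rfl fun k _ => Finset.sum_congr rfl fun l _ => ?_
      simp only [wΩ]
      field_simp
    exact (mul_eq_zero.mp h2).resolve_left hs0
  obtain ⟨f, P, hPV, hPf⟩ := V.exists_rows_with_identity_block Y hdet
  let κ : K →+* V := (algebraMap K Ω).codRestrict V hVK
  obtain ⟨huV, huV'⟩ := V.mem_nonunits_iff_exists_mem_maximalIdeal.mp hVu
  let ZV : I → N → V := fun i k => ⟨(P * Y) i k, hPV i k⟩
  let ρ : V →+* IsLocalRing.ResidueField V := IsLocalRing.residue V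
  have hρu : ρ ⟨s⁻¹, huV⟩ = 0 := (IsLocalRing.residue_eq_zero_iff _).mpr huV'
  refine ⟨f, exists_formOnRows_eq_zero_of_extension (ρ.comp κ) w f
    (Z := fun i k => ρ (ZV i k)) (fun i j => ?_) (fun a i j => ?_)⟩
  · have : ZV i (f j) = if i = j then 1 else 0 := by
      apply Subtype.ext
      simp only [ZV, hPf]
      split_ifs <;> rfl
    rw [this]
    split_ifs <;> simp
  · have h0 : formOnRows (fun k l => (⟨s⁻¹, huV⟩ : V) * κ (w₀ a k l) + κ (w a k l)) ZV i j = 0 := by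
      apply Subtype.val_injective
      exact (map_formOnRows V.subtype _ ZV i j).trans (formOnRows_mul_eq_zero P (hY' a) i j)
    have h1 := congrArg ρ h0
    rw [map_formOnRows, map_zero] at h1
    simp only [map_add, map_mul, hρu, zero_mul, zero_add] at h1
    exact h1

open PowerSeries in
theorem IsNondegeneratePairing.exists_isotropic_rows {K T C I : Type*} [Field K] [IsAlgClosed K]
    [Fintype T] [Fintype I] [Fintype C] [DecidableEq I] {B : T → C → I → K}
    (hB : IsNondegeneratePairing B) {w : T → I ⊕ C → I ⊕ C → K} (halt : ∀ a k, w a k k = 0)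
    (hskew : ∀ a k l, w a k l = -w a l k) :
    ∃ (f : I → I ⊕ C) (Y : I → I ⊕ C → K), (∀ i j, Y i (f j) = if i = j then 1 else 0) ∧
      ∀ a i j, formOnRows (w a) Y i j = 0 := by
  obtain ⟨φ, hφ⟩ := hB.exists_powerSeries halt hskew
  let ι : K⟦X⟧ →+* FractionRing K⟦X⟧ := algebraMap K⟦X⟧ (FractionRing K⟦X⟧)
  have hι : Function.Injective ι := IsFractionRing.injective K⟦X⟧ (FractionRing K⟦X⟧)
  have hιC : ∀ x : K, ι (PowerSeries.C x) = algebraMap K (FractionRing K⟦X⟧) x := fun x =>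
    (IsScalarTower.algebraMap_apply K K⟦X⟧ (FractionRing K⟦X⟧) x).symm
  have hX : Transcendental K (ι X) :=
    (transcendental_algebraMap_iff hι).mpr (PowerSeries.transcendental_X K)
  refine exists_formOnRows_eq_zero_of_pencil hX (fun a => hyperbolicForm (B a)) w
    (Y := Matrix.of fun i k => ι (graphRows φ i k)) (f₀ := Sum.inl) ?_ (fun a i j => ?_)
  · have : (Matrix.of fun i k => ι (graphRows φ i k)).submatrix id Sum.inl =
        (1 : Matrix I I (FractionRing K⟦X⟧)) := by
      ext i j
      rw [Matrix.submatrix_apply, Matrix.of_apply, graphRows, Sum.elim_inl, Matrix.one_apply,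
        Pi.single_apply, apply_ite ι, map_one, map_zero]
      simp only [id, eq_comm]
    rw [this, Matrix.det_one]
    exact one_ne_zero
  · have h := congrArg ι (hφ a i j)
    rw [map_formOnRows, map_zero] at h
    simp only [map_add, map_mul, hιC] at h
    exact h

theorem commSubmodule_eq_span (K L : Type) [Field K] [LieRing L] [LieAlgebra K L] :
    commSubmodule K L = Submodule.span K {z | ∃ x y : L, ⁅x, y⁆ = z} := by
  rw [commSubmodule, LieSubmodule.lieIdeal_oper_eq_linear_span]
  congr 1
  ext z
  constructor
  · rintro ⟨x, y, h⟩
    exact ⟨x, y, h⟩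
  · rintro ⟨x, y, h⟩
    exact ⟨⟨x, trivial⟩, ⟨y, trivial⟩, h⟩

theorem lie_mem_commSubmodule (K : Type) {L : Type} [Field K] [LieRing L] [LieAlgebra K L]
    (x y : L) : ⁅x, y⁆ ∈ commSubmodule K L := by
  rw [commSubmodule_eq_span]
  exact Submodule.subset_span ⟨x, y, rfl⟩

theorem lie_eq_zero_of_mem_commSubmodule {K L : Type} [Field K] [LieRing L] [LieAlgebra K L]
    (h2step : ∀ x y z : L, ⁅x, ⁅y, z⁆⁆ = 0) (x : L) {z : L} (hz : z ∈ commSubmodule K L) :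
    ⁅x, z⁆ = 0 := by
  rw [commSubmodule_eq_span] at hz
  induction hz using Submodule.span_induction with
  | mem z h =>
    obtain ⟨a, b, rfl⟩ := h
    exact h2step x a b
  | zero => exact lie_zero x
  | add a b _ _ ha hb => rw [lie_add, ha, hb, add_zero]
  | smul c a _ ha => rw [lie_smul, ha, smul_zero]

theorem LieSubalgebra.exists_isLieAbelian_of_commuting_span {K L : Type} [Field K] [LieRing L]
    [LieAlgebra K L] {s : Set L} (hs : ∀ x ∈ s, ∀ y ∈ s, ⁅x, y⁆ = 0) :
    ∃ H : LieSubalgebra K L, IsLieAbelian H ∧ H.toSubmodule = Submodule.span K s := by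
  have key : ∀ x ∈ Submodule.span K s, ∀ y ∈ Submodule.span K s, ⁅x, y⁆ = 0 := by
    intro x hx y hy
    induction hx, hy using Submodule.span_induction₂ with
    | mem_mem x y hx hy => exact hs x hx y hy
    | zero_left y _ => exact zero_lie y
    | zero_right x _ => exact lie_zero x
    | add_left x y z _ _ _ h1 h2 => rw [add_lie, h1, h2, add_zero]
    | add_right x y z _ _ _ h1 h2 => rw [lie_add, h1, h2, add_zero]
    | smul_left r x y _ _ h => rw [smul_lie, h, smul_zero]
    | smul_right r x y _ _ h => rw [lie_smul, h, smul_zero]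
  refine ⟨{ Submodule.span K s with
    lie_mem' := fun {x y} hx hy => (key x hx y hy).symm ▸ Submodule.zero_mem _ }, ⟨?_⟩, rfl⟩
  rintro ⟨x, hx⟩ ⟨y, hy⟩
  exact Subtype.ext (key x hx y hy)

theorem exists_commuting_linearIndependent {K L : Type} [Field K] [IsAlgClosed K] [LieRing L]
    [LieAlgebra K L] [Module.Finite K L] {m p t : ℕ} (ht : 2 ≤ t) (hmp : t * (m - 1) ≤ 2 * p)
    (hdim : Module.finrank K (commSubmodule K L) = t) {C : Submodule K L}
    (hC : Module.finrank K C = m + p) :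
    ∃ x : Fin m → C, LinearIndependent K x ∧ ∀ i j, ⁅(x i : L), (x j : L)⁆ = 0 := by
  obtain ⟨B, hB⟩ := exists_nondegeneratePairing K ht hmp
  let b : Module.Basis (Fin m ⊕ Fin p) K C :=
    (Module.finBasisOfFinrankEq K C hC).reindex finSumFinEquiv.symm
  let z : Module.Basis (Fin t) K (commSubmodule K L) := Module.finBasisOfFinrankEq K _ hdim
  let br : Fin m ⊕ Fin p → Fin m ⊕ Fin p → commSubmodule K L := fun k l =>
    ⟨⁅(b k : L), (b l : L)⁆, lie_mem_commSubmodule K _ _⟩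
  have hbr0 : ∀ k, br k k = 0 := fun k => Subtype.ext (lie_self _)
  have hbrs : ∀ k l, br k l = -br l k := fun k l => Subtype.ext (lie_skew _ _).symm
  obtain ⟨f, Y, hYf, hY⟩ := hB.exists_isotropic_rows (w := fun a k l => z.repr (br k l) a)
    (fun a k => by rw [hbr0, map_zero, Finsupp.zero_apply])
    (fun a k l => by rw [hbrs k l, map_neg, Finsupp.neg_apply])
  refine ⟨fun i => ∑ k, Y i k • b k, ?_, fun i j => ?_⟩
  · rw [Fintype.linearIndependent_iff]
    intro c hc j
    have h := congrArg (fun v => b.repr v (f j)) hc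
    simpa [Finsupp.single_apply, hYf, -Fintype.sum_sum_type] using h
  · have h : ∑ k, ∑ l, (Y i k * Y j l) • br k l = 0 := by
      apply z.repr.injective
      ext a
      simpa [formOnRows, Finsupp.finsetSum_apply] using hY a i j
    have h' := congrArg (commSubmodule K L).subtype h
    rw [Finset.sum_comm] at h'
    simpa [br, sum_lie, lie_sum, smul_smul, Finset.smul_sum, mul_comm,
      -Fintype.sum_sum_type] using h'

/-- Over an algebraically closed field, every 2-step nilpotent Lie algebra
with dim L/[L,L] = n and dim [L,L] = t (2 ≤ t ≤ n(n−1)/2) contains an abelian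
subalgebra of dimension ⌊(2n + t² + 3t)/(t + 2)⌋. -/
theorem exists_abelian_subalgebra_of_dim
    (K : Type) [Field K] [IsAlgClosed K] (n t : ℕ) (hn : 0 < n)
    (ht : 2 ≤ t) (htop : 2 * t ≤ n * (n - 1))
    (L : Type) [LieRing L] [LieAlgebra K L] [Module.Finite K L]
    (h2step : ∀ x y z : L, ⁅x, ⁅y, z⁆⁆ = 0)
    (hnonab : ¬ ∀ x y : L, ⁅x, y⁆ = 0)
    (hdim1 : Module.finrank K (L ⧸ commSubmodule K L) = n)
    (hdim2 : Module.finrank K (commSubmodule K L) = t) :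
    ∃ H : LieSubalgebra K L, IsLieAbelian H ∧
      Module.finrank K H = (2 * n + t ^ 2 + 3 * t) / (t + 2) := by
  obtain ⟨m, hm⟩ : ∃ m, m = (2 * n + t) / (t + 2) := ⟨_, rfl⟩
  have hs : (2 * n + t ^ 2 + 3 * t) / (t + 2) = m + t := by
    rw [show 2 * n + t ^ 2 + 3 * t = 2 * n + t + t * (t + 2) by ring,
      Nat.add_mul_div_right _ _ (by omega), hm]
  have hmle : m * (t + 2) ≤ 2 * n + t := hm ▸ Nat.div_mul_le_self _ _
  have hmn : m ≤ n := by
    by_contra! h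
    obtain ⟨e, rfl⟩ := Nat.exists_eq_add_of_lt h
    nlinarith
  obtain ⟨p, rfl⟩ := Nat.exists_eq_add_of_le hmn
  have hmp : t * (m - 1) ≤ 2 * p := by
    rcases m with _ | m
    · simp
    · rw [Nat.add_sub_cancel]
      nlinarith
  obtain ⟨C, hC⟩ := Submodule.exists_isCompl (commSubmodule K L)
  have hCdim : Module.finrank K C = m + p :=
    (Submodule.quotientEquivOfIsCompl _ _ hC).finrank_eq.symm.trans hdim1
  obtain ⟨x, hx, hxc⟩ := exists_commuting_linearIndependent ht hmp hdim2 hCdim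
  let y : Fin m → L := fun i => x i
  have hy : LinearIndependent K y := hx.map' C.subtype C.ker_subtype
  obtain ⟨H, hH, hHs⟩ := LieSubalgebra.exists_isLieAbelian_of_commuting_span (K := K)
    (s := Set.range y ∪ commSubmodule K L) (by
      rintro a ha c (⟨j, rfl⟩ | hc)
      · rcases ha with ⟨i, rfl⟩ | ha
        · exact hxc i j
        · rw [← lie_skew, lie_eq_zero_of_mem_commSubmodule h2step _ ha, neg_zero]
      · exact lie_eq_zero_of_mem_commSubmodule h2step _ hc)
  refine ⟨H, hH, ?_⟩
  have hinf : Submodule.span K (Set.range y) ⊓ commSubmodule K L = ⊥ := by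
    refine (hC.symm.disjoint.mono_left (Submodule.span_le.mpr ?_)).eq_bot
    rintro _ ⟨i, rfl⟩
    exact (x i).2
  have hsum := Submodule.finrank_sup_add_finrank_inf_eq (Submodule.span K (Set.range y))
    (commSubmodule K L)
  rw [hinf, finrank_bot, add_zero, finrank_span_eq_card hy, Fintype.card_fin, hdim2] at hsum
  rw [Submodule.span_union, Submodule.span_eq] at hHs
  rw [hs, ← hsum, ← hHs]
  rfl
end

section
/- Define three alternating bilinear forms on ℝ⁴ by φ₁(x,y) = x₁y₂ − x₂y₁ + x₃y₄ − x₄y₃, φ₂(x,y) = x₁y₃ − x₃y₁ − x₂y₄ + x₄y₂, and φ₃(x,y) = x₁y₄ − x₄y₁ + x₂y₃ − x₃y₂. Then for every nonzero x ∈ ℝ⁴, every y ∈ ℝ⁴ satisfying φ₁(x,y) = φ₂(x,y) = φ₃(x,y) = 0 is a scalar multiple of x. Consequently there is no 2-dimensional subspace of ℝ⁴ that is totally isotropic simultaneously for φ₁, φ₂ and φ₃, and the 2-step nilpotent Lie algebra L(φ₁,φ₂,φ₃) of 𝔑₂^ℝ(4,3) has no abelian subalgebra of dimension 5. -/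
/-- A `t`-tuple of alternating bilinear forms on `K^n`. -/
structure AltTuple (K : Type) [Field K] (n t : ℕ) : Type where
  φ : Fin t → LinearMap.BilinForm K (Fin n → K)
  alt : ∀ r, (φ r).IsAlt

namespace AltTuple

variable {K : Type} [Field K] {n t : ℕ}

/-- The underlying vector space `K^n × K^t` of the 2-step nilpotent Lie algebra `L(Φ)`. -/
def L (Φ : AltTuple K n t) : Type := (Fin n → K) × (Fin t → K)

instance (Φ : AltTuple K n t) : AddCommGroup Φ.L :=
  inferInstanceAs (AddCommGroup ((Fin n → K) × (Fin t → K)))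

instance (Φ : AltTuple K n t) : Module K Φ.L :=
  inferInstanceAs (Module K ((Fin n → K) × (Fin t → K)))

/-- The Lie ring structure on `L(Φ)`:
`⁅(x,a),(y,b)⁆ = (0, (φ₁(x,y),…,φ_t(x,y)))`. -/
instance (Φ : AltTuple K n t) : LieRing Φ.L where
  bracket x y := ((0 : Fin n → K), fun r => Φ.φ r x.1 y.1)
  add_lie x y z := by
    show ((0 : Fin n → K), fun r => Φ.φ r (x.1 + y.1) z.1)
        = (((0 : Fin n → K), fun r => Φ.φ r x.1 z.1)
            + ((0 : Fin n → K), fun r => Φ.φ r y.1 z.1) : (Fin n → K) × (Fin t → K))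
    refine Prod.ext (by simp) ?_
    funext r
    simp [map_add]
  lie_add x y z := by
    show ((0 : Fin n → K), fun r => Φ.φ r x.1 (y.1 + z.1))
        = (((0 : Fin n → K), fun r => Φ.φ r x.1 y.1)
            + ((0 : Fin n → K), fun r => Φ.φ r x.1 z.1) : (Fin n → K) × (Fin t → K))
    refine Prod.ext (by simp) ?_
    funext r
    simp [map_add]
  lie_self x := by
    show ((0 : Fin n → K), fun r => Φ.φ r x.1 x.1) = ((0, 0) : (Fin n → K) × (Fin t → K))
    refine Prod.ext rfl ?_
    funext r
    exact Φ.alt r x.1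
  leibniz_lie x y z := by
    show ((0 : Fin n → K), fun r => Φ.φ r x.1 (0 : Fin n → K))
        = (((0 : Fin n → K), fun r => Φ.φ r (0 : Fin n → K) z.1)
            + ((0 : Fin n → K), fun r => Φ.φ r y.1 (0 : Fin n → K)) : (Fin n → K) × (Fin t → K))
    refine Prod.ext (by simp) ?_
    funext r
    simp

instance (Φ : AltTuple K n t) : LieAlgebra K Φ.L where
  lie_smul c x y := by
    show ((0 : Fin n → K), fun r => Φ.φ r x.1 (c • y.1))
        = (c • (((0 : Fin n → K), fun r => Φ.φ r x.1 y.1) : (Fin n → K) × (Fin t → K)))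
    refine Prod.ext (by simp) ?_
    funext r
    simp

/-- The point of `K^{t·n²}` recording the matrix entries `φ_r(e_i,e_j)` of the forms. -/
def evalPoint (Φ : AltTuple K n t) : Fin t × Fin n × Fin n → K :=
  fun p => Φ.φ p.1 (Pi.single p.2.1 1) (Pi.single p.2.2 1)

end AltTuple

open LinearMap (mk₂)

/-- φ₁(x,y) = x₁y₂ − x₂y₁ + x₃y₄ − x₄y₃ (indices shifted to 0,…,3). -/
noncomputable def phi1 : LinearMap.BilinForm ℝ (Fin 4 → ℝ) :=
  mk₂ ℝ (fun x y => x 0 * y 1 - x 1 * y 0 + x 2 * y 3 - x 3 * y 2)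
    (fun m₁ m₂ y => by simp; ring) (fun c m y => by simp; ring)
    (fun x n₁ n₂ => by simp; ring) (fun c x y => by simp; ring)

/-- φ₂(x,y) = x₁y₃ − x₃y₁ − x₂y₄ + x₄y₂. -/
noncomputable def phi2 : LinearMap.BilinForm ℝ (Fin 4 → ℝ) :=
  mk₂ ℝ (fun x y => x 0 * y 2 - x 2 * y 0 - x 1 * y 3 + x 3 * y 1)
    (fun m₁ m₂ y => by simp; ring) (fun c m y => by simp; ring)
    (fun x n₁ n₂ => by simp; ring) (fun c x y => by simp; ring)

/-- φ₃(x,y) = x₁y₄ − x₄y₁ + x₂y₃ − x₃y₂. -/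
noncomputable def phi3 : LinearMap.BilinForm ℝ (Fin 4 → ℝ) :=
  mk₂ ℝ (fun x y => x 0 * y 3 - x 3 * y 0 + x 1 * y 2 - x 2 * y 1)
    (fun m₁ m₂ y => by simp; ring) (fun c m y => by simp; ring)
    (fun x n₁ n₂ => by simp; ring) (fun c x y => by simp; ring)

/-- The triple (φ₁,φ₂,φ₃) as an element of the class defining 𝔑₂^ℝ(4,3). -/
noncomputable def Phi843 : AltTuple ℝ 4 3 where
  φ := ![phi1, phi2, phi3]
  alt := by
    intro r
    fin_cases r <;> intro x <;>
      simp [phi1, phi2, phi3, LinearMap.mk₂_apply] <;> ring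

namespace AltTuple

variable {K : Type} [Field K] {n t : ℕ}

/-- The projection of `L(Φ) = K^n × K^t` onto `K^n`. -/
def proj (Φ : AltTuple K n t) : Φ.L →ₗ[K] (Fin n → K) :=
  LinearMap.fst K (Fin n → K) (Fin t → K)

/-- The projection of `L(Φ) = K^n × K^t` onto the central summand `K^t`. -/
def centralProj (Φ : AltTuple K n t) : Φ.L →ₗ[K] (Fin t → K) :=
  LinearMap.snd K (Fin n → K) (Fin t → K)

theorem eq_zero_of_proj_eq_zero (Φ : AltTuple K n t) {u : Φ.L}
    (h₁ : Φ.proj u = 0) (h₂ : Φ.centralProj u = 0) : u = 0 :=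
  Prod.ext h₁ h₂

theorem φ_proj_eq_zero_of_lie_eq_zero (Φ : AltTuple K n t) {u v : Φ.L} (h : ⁅u, v⁆ = 0)
    (r : Fin t) : Φ.φ r (Φ.proj u) (Φ.proj v) = 0 :=
  congrFun (congrArg Φ.centralProj h) r

theorem finrank_le_finrank_map_proj_add (Φ : AltTuple K n t) (S : Submodule K Φ.L) :
    Module.finrank K S ≤ Module.finrank K (S.map Φ.proj) + t := by
  have : FiniteDimensional K Φ.L :=
    inferInstanceAs (FiniteDimensional K ((Fin n → K) × (Fin t → K)))
  have hinj : Function.Injective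
      ((Φ.centralProj.domRestrict S).domRestrict (LinearMap.ker (Φ.proj.domRestrict S))) := by
    rw [injective_iff_map_eq_zero]
    rintro ⟨u, hu⟩ hu'
    exact Subtype.ext (Subtype.ext (Φ.eq_zero_of_proj_eq_zero hu hu'))
  have hker := LinearMap.finrank_le_finrank_of_injective hinj
  rw [Module.finrank_fin_fun] at hker
  have hrank := LinearMap.finrank_range_add_finrank_ker (Φ.proj.domRestrict S)
  rw [LinearMap.range_domRestrict] at hrank
  lia

end AltTuple

theorem exists_eq_smul_of_phi_eq_zero {x y : Fin 4 → ℝ} (hx : x ≠ 0)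
    (h₁ : phi1 x y = 0) (h₂ : phi2 x y = 0) (h₃ : phi3 x y = 0) : ∃ c : ℝ, y = c • x := by
  simp only [phi1, phi2, phi3, LinearMap.mk₂_apply] at h₁ h₂ h₃
  have hN : x 0 ^ 2 + x 1 ^ 2 + x 2 ^ 2 + x 3 ^ 2 ≠ 0 := by
    have h : x ⬝ᵥ x ≠ 0 := dotProduct_self_eq_zero.not.mpr hx
    simpa [dotProduct, Fin.sum_univ_four, sq] using h
  refine ⟨(x 0 * y 0 + x 1 * y 1 + x 2 * y 2 + x 3 * y 3) /
    (x 0 ^ 2 + x 1 ^ 2 + x 2 ^ 2 + x 3 ^ 2), funext fun i => ?_⟩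
  rw [Pi.smul_apply, smul_eq_mul, div_mul_eq_mul_div, eq_div_iff hN]
  fin_cases i <;> simp only [Fin.zero_eta, Fin.mk_one, Fin.reduceFinMk]
  · linear_combination -x 1 * h₁ - x 2 * h₂ - x 3 * h₃
  · linear_combination x 0 * h₁ + x 3 * h₂ - x 2 * h₃
  · linear_combination -x 3 * h₁ + x 0 * h₂ + x 1 * h₃
  · linear_combination x 2 * h₁ - x 1 * h₂ + x 0 * h₃

theorem finrank_le_one_of_phi_eq_zero (W : Submodule ℝ (Fin 4 → ℝ))
    (hW : ∀ x ∈ W, ∀ y ∈ W, phi1 x y = 0 ∧ phi2 x y = 0 ∧ phi3 x y = 0) :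
    Module.finrank ℝ W ≤ 1 := by
  rcases eq_or_ne W ⊥ with rfl | hbot
  · simp
  · obtain ⟨x, hx, hx0⟩ := W.exists_mem_ne_zero_of_ne_bot hbot
    refine finrank_le_one ⟨x, hx⟩ fun ⟨y, hy⟩ => ?_
    obtain ⟨h₁, h₂, h₃⟩ := hW x hx y hy
    obtain ⟨c, hc⟩ := exists_eq_smul_of_phi_eq_zero hx0 h₁ h₂ h₃
    exact ⟨c, Subtype.ext hc.symm⟩

/-- for the above forms, any y orthogonal to a nonzero x with respect to
all three forms is proportional to x; hence there is no common 2-dimensional totally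
isotropic subspace, and L(φ₁,φ₂,φ₃) has no abelian subalgebra of dimension 5. -/
theorem real_example_no_abelian_dim_five :
    (∀ x : Fin 4 → ℝ, x ≠ 0 → ∀ y : Fin 4 → ℝ,
      phi1 x y = 0 → phi2 x y = 0 → phi3 x y = 0 → ∃ c : ℝ, y = c • x)
    ∧ (¬ ∃ W : Submodule ℝ (Fin 4 → ℝ), Module.finrank ℝ W = 2 ∧
        ∀ x ∈ W, ∀ y ∈ W, phi1 x y = 0 ∧ phi2 x y = 0 ∧ phi3 x y = 0)
    ∧ (¬ ∃ H : LieSubalgebra ℝ Phi843.L, IsLieAbelian H ∧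
        Module.finrank ℝ H = 5) := by
  refine ⟨fun x hx y => exists_eq_smul_of_phi_eq_zero hx, ?_, ?_⟩
  · rintro ⟨W, hdim, hW⟩
    have := finrank_le_one_of_phi_eq_zero W hW
    lia
  · rintro ⟨H, hab, hdim⟩
    have hle : Module.finrank ℝ (H.toSubmodule.map Phi843.proj) ≤ 1 := by
      refine finrank_le_one_of_phi_eq_zero _ ?_
      rintro _ ⟨u, hu, rfl⟩ _ ⟨v, hv, rfl⟩
      have huv : ⁅u, v⁆ = 0 := congrArg Subtype.val (hab.trivial ⟨u, hu⟩ ⟨v, hv⟩)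
      have h := Phi843.φ_proj_eq_zero_of_lie_eq_zero huv
      exact ⟨h 0, h 1, h 2⟩
    have hdim' : Module.finrank ℝ H.toSubmodule = 5 := hdim
    have := Phi843.finrank_le_finrank_map_proj_add H.toSubmodule
    lia
end

section
/- Let K be an infinite field and let n, N, t be positive integers with N < n, t ≤ n(n−1)/2, and 2t < n² − n(2N − 1) + N(N−1) + 2. Then there exists a nonzero polynomial P in the t·n² variables X_{r,i,j} with coefficients in K such that for every t-tuple Φ = (φ₁,…,φ_t) of linearly independent alternating bilinear forms on K^n for which L(Φ) admits a surjective Lie algebra homomorphism onto some non-abelian Lie algebra of dimension N over K, P vanishes at the point (φ_r(e_i,e_j))_{r,i,j}, where e₁,…,e_n is the standard basis of K^n. (That is, a generic Lie algebra of 𝔑₂(n,t) admits no surjective homomorphism onto a non-commutative Lie algebra of dimension N.) -/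
namespace AltTuple

/-- Pairs `i < j` of indices: the positions of the strictly upper triangular entries. -/
abbrev UpperPair (n : ℕ) : Type := {p : Fin n × Fin n // p.1 < p.2}

theorem card_upperPair_mul_two (n : ℕ) : Fintype.card (UpperPair n) * 2 = n * (n - 1) := by
  have e : UpperPair n ≃ Σ j : Fin n, Fin j :=
    { toFun := fun p => ⟨p.1.2, ⟨p.1.1, p.2⟩⟩
      invFun := fun q => ⟨(⟨q.2, q.2.2.trans q.1.2⟩, q.1), q.2.2⟩
      left_inv := fun _ => rfl
      right_inv := fun _ => rfl }
  rw [Fintype.card_congr e, Fintype.card_sigma]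
  simp only [Fintype.card_fin]
  rw [Fin.sum_univ_eq_sum_range (fun i => i) n, Finset.sum_range_id_mul_two]

/-- More polynomials than variables satisfy a nontrivial polynomial relation. -/
theorem exists_ne_zero_aeval_eq_zero {K ι τ : Type} [Field K] [Fintype ι] [Fintype τ]
    (F : ι → MvPolynomial τ K) (h : Fintype.card τ < Fintype.card ι) :
    ∃ P : MvPolynomial ι K, P ≠ 0 ∧ MvPolynomial.aeval F P = 0 := by
  by_contra! hF
  have hind : AlgebraicIndependent K F :=
    (injective_iff_map_eq_zero _).2 fun P hP => by
      by_contra hP0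
      exact hF P hP0 hP
  have hle := hind.cardinalMk_le_trdeg
  rw [MvPolynomial.trdeg_of_isDomain] at hle
  simp only [Cardinal.mk_fintype, Cardinal.lift_natCast, Nat.cast_le] at hle
  omega

section Parametrization

variable {k m n t : ℕ} {R S : Type} [CommRing R] [CommRing S]

/-- The skew-symmetric matrix with the given strictly upper triangular entries. -/
def skewEntry (b : UpperPair k → R) (i j : Fin k) : R :=
  if h : i < j then b ⟨(i, j), h⟩ else if h : j < i then -b ⟨(j, i), h⟩ else 0

/-- The `k × n` matrix whose pivot columns, selected by `e`, form the identity matrix and whose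
other columns are those of `C`. -/
def pivotEntry (e : Fin k ⊕ Fin m ≃ Fin n) (C : Fin k × Fin m → R) (i : Fin k) (j : Fin n) : R :=
  Sum.elim (fun i' => if i = i' then 1 else 0) (fun j' => C (i, j')) (e.symm j)

/-- The entries of the congruence transform `AᵀBA` of the skew-symmetric matrix `B` given by `b`
by the matrix `A` with pivots `e` given by `C`. -/
def lowRankEntry (e : Fin k ⊕ Fin m ≃ Fin n) (C : Fin k × Fin m → R) (b : UpperPair k → R)
    (j l : Fin n) : R :=
  ∑ i, ∑ i', pivotEntry e C i j * pivotEntry e C i' l * skewEntry b i i'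

theorem map_skewEntry (f : R →+* S) (b : UpperPair k → R) (i j : Fin k) :
    f (skewEntry b i j) = skewEntry (f ∘ b) i j := by
  unfold skewEntry
  split_ifs <;> simp

theorem map_pivotEntry (f : R →+* S) (e : Fin k ⊕ Fin m ≃ Fin n) (C : Fin k × Fin m → R)
    (i : Fin k) (j : Fin n) : f (pivotEntry e C i j) = pivotEntry e (f ∘ C) i j := by
  unfold pivotEntry
  rcases e.symm j with i' | j'
  · simp [apply_ite f]
  · simp

theorem map_lowRankEntry (f : R →+* S) (e : Fin k ⊕ Fin m ≃ Fin n) (C : Fin k × Fin m → R)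
    (b : UpperPair k → R) (j l : Fin n) :
    f (lowRankEntry e C b j l) = lowRankEntry e (f ∘ C) (f ∘ b) j l := by
  simp only [lowRankEntry, map_sum, map_mul, map_skewEntry, map_pivotEntry]

/-- Parameters for the tuples of forms whose member of index `r₀` is the sum of a linear
combination of the others and a form of rank at most `k`: the entries of the other members, the
coefficients of the linear combination, and the two matrices describing the form of low rank. -/
abbrev Param (k m n : ℕ) (r₀ : Fin t) : Type :=
  (({r : Fin t // r ≠ r₀} × UpperPair n) ⊕ {r : Fin t // r ≠ r₀}) ⊕
    ((Fin k × Fin m) ⊕ UpperPair k)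

/-- The upper triangular entries of the tuple of forms with the given parameters. -/
def paramEntry (e : Fin k ⊕ Fin m ≃ Fin n) (r₀ : Fin t) (x : Param k m n r₀ → R)
    (q : Fin t × UpperPair n) : R :=
  if h : q.1 = r₀ then
    lowRankEntry e (fun p => x (.inr (.inl p))) (fun p => x (.inr (.inr p))) q.2.1.1 q.2.1.2 +
      ∑ r, x (.inl (.inr r)) * x (.inl (.inl (r, q.2)))
  else x (.inl (.inl (⟨q.1, h⟩, q.2)))

theorem map_paramEntry (f : R →+* S) (e : Fin k ⊕ Fin m ≃ Fin n) (r₀ : Fin t)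
    (x : Param k m n r₀ → R) (q : Fin t × UpperPair n) :
    f (paramEntry e r₀ x q) = paramEntry e r₀ (f ∘ x) q := by
  unfold paramEntry
  split_ifs
  · simp only [map_add, map_lowRankEntry, map_sum, map_mul]
    rfl
  · rfl

theorem card_param_lt (r₀ : Fin t) (hk : k + m = n) (h : 2 * t < m * (m - 1) + 2) :
    Fintype.card (Param k m n r₀) < Fintype.card (Fin t × UpperPair n) := by
  have hn := card_upperPair_mul_two n
  have hkk := card_upperPair_mul_two k
  have ht : Fintype.card {r : Fin t // r ≠ r₀} = t - 1 := by simp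
  have htpos := r₀.pos
  simp only [Fintype.card_sum, Fintype.card_prod, Fintype.card_fin, ht]
  generalize Fintype.card (UpperPair n) = u at *
  generalize Fintype.card (UpperPair k) = v at *
  obtain ⟨s, rfl⟩ : ∃ s, t = s + 1 := ⟨t - 1, by omega⟩
  have hm : 2 ≤ m := by
    by_contra! hm
    interval_cases m <;> omega
  obtain ⟨m, rfl⟩ : ∃ m', m = m' + 1 := ⟨m - 1, by omega⟩
  subst hk
  rcases k with _ | k
  · simp only [Nat.add_sub_cancel, zero_add, zero_mul] at *
    nlinarith
  · simp only [Nat.add_sub_cancel, ← add_assoc] at *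
    nlinarith

end Parametrization

variable {K : Type} [Field K] {n t : ℕ}

theorem skewEntry_eq_of_isAlt {k : ℕ} {V : Type} [AddCommGroup V] [Module K V]
    {ω : LinearMap.BilinForm K V} (hω : ω.IsAlt) (v : Fin k → V) (i j : Fin k) :
    skewEntry (fun p : UpperPair k => ω (v p.1.1) (v p.1.2)) i j = ω (v i) (v j) := by
  unfold skewEntry
  split_ifs with h h'
  · rfl
  · exact hω.neg_eq _ _
  · obtain rfl : i = j := by omega
    exact (hω _).symm

/-- A family of `n` vectors in a space of dimension at most `k` is spanned by `k` of its members,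
which are the pivots of a matrix expressing the whole family. -/
theorem exists_pivots {k m : ℕ} (hk : k + m = n) {V : Type} [AddCommGroup V] [Module K V]
    [FiniteDimensional K V] (hV : Module.finrank K V ≤ k) (v : Fin n → V) :
    ∃ (e : Fin k ⊕ Fin m ≃ Fin n) (C : Fin k × Fin m → K),
      ∀ j, v j = ∑ i, pivotEntry e C i j • v (e (.inl i)) := by
  classical
  obtain ⟨κ, a, ha, hspan, hli⟩ := exists_linearIndependent' K v
  have : Fintype κ := Fintype.ofInjective a ha
  have hcard : (Finset.univ.image a).card ≤ k := by
    rw [Finset.card_image_of_injective _ ha, Finset.card_univ]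
    exact hli.fintype_card_le_finrank.trans hV
  obtain ⟨s, hs, hsk⟩ := Finset.exists_superset_card_eq hcard (by simp; omega)
  have hsm : sᶜ.card = m := by
    rw [Finset.card_compl, hsk, Fintype.card_fin]
    omega
  let e : Fin k ⊕ Fin m ≃ Fin n := finSumEquivOfFinset hsk hsm
  have hmem (j : Fin n) : v j ∈ Submodule.span K (Set.range fun i => v (e (.inl i))) := by
    have hj : v j ∈ Submodule.span K (Set.range (v ∘ a)) :=
      hspan ▸ Submodule.subset_span ⟨j, rfl⟩
    refine Submodule.span_mono ?_ hj
    rintro _ ⟨x, rfl⟩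
    have hx : a x ∈ Set.range (s.orderEmbOfFin hsk) := by
      rw [Finset.range_orderEmbOfFin]
      exact hs (Finset.mem_image_of_mem a (Finset.mem_univ x))
    obtain ⟨i, hi⟩ := hx
    exact ⟨i, by simp [e, hi]⟩
  choose c hc using fun j => (Submodule.mem_span_range_iff_exists_fun K).1 (hmem j)
  refine ⟨e, fun p => c (e (.inr p.2)) p.1, fun j => ?_⟩
  obtain ⟨j, rfl⟩ := e.surjective j
  rcases j with i | j
  · simp [pivotEntry]
  · simp [pivotEntry, hc]

/-- A form whose radical contains a subspace of codimension at most `k` is the form of low rank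
attached to a suitable choice of pivots and parameters. -/
theorem exists_lowRankEntry_eq {k m : ℕ} (hk : k + m = n)
    {ω : LinearMap.BilinForm K (Fin n → K)} (hω : ω.IsAlt) (U : Submodule K (Fin n → K))
    (hU : Module.finrank K ((Fin n → K) ⧸ U) ≤ k) (hUω : ∀ x ∈ U, ∀ y, ω x y = 0) :
    ∃ (e : Fin k ⊕ Fin m ≃ Fin n) (C : Fin k × Fin m → K) (b : UpperPair k → K),
      ∀ j l, ω (Pi.single j 1) (Pi.single l 1) = lowRankEntry e C b j l := by
  obtain ⟨e, C, hC⟩ := exists_pivots hk hU fun j => U.mkQ (Pi.single j 1)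
  let v : Fin k → Fin n → K := fun i => Pi.single (e (.inl i)) 1
  refine ⟨e, C, fun p => ω (v p.1.1) (v p.1.2), fun j l => ?_⟩
  have hleft (j : Fin n) (y : Fin n → K) :
      ω (Pi.single j 1) y = ∑ i, pivotEntry e C i j * ω (v i) y := by
    have hmem : Pi.single j 1 - ∑ i, pivotEntry e C i j • v i ∈ U := by
      rw [← U.ker_mkQ, LinearMap.mem_ker, map_sub, map_sum, sub_eq_zero, hC j]
      simp [v]
    have := hUω _ hmem y
    simpa [sub_eq_zero] using this
  have hright (l : Fin n) (x : Fin n → K) :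
      ω x (Pi.single l 1) = ∑ i, pivotEntry e C i l * ω x (v i) := by
    rw [← hω.neg_eq, hleft, ← Finset.sum_neg_distrib]
    exact Finset.sum_congr rfl fun i _ => by rw [← hω.neg_eq x (v i)]; ring
  simp only [lowRankEntry, skewEntry_eq_of_isAlt hω]
  rw [hleft]
  refine Finset.sum_congr rfl fun i _ => ?_
  rw [hright, Finset.mul_sum]
  exact Finset.sum_congr rfl fun i' _ => by ring

/-- If `L(Φ)` surjects onto a non-abelian Lie algebra of dimension at most `k + 1`, then modulo the
other members of `Φ` one of them has a radical of codimension at most `k`. -/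
theorem exists_radical_of_surjective (Φ : AltTuple K n t) {M : Type} [LieRing M] [LieAlgebra K M]
    [Module.Finite K M] {k : ℕ} (hM : Module.finrank K M ≤ k + 1)
    (hna : ¬ ∀ x y : M, ⁅x, y⁆ = 0) (f : Φ.L →ₗ⁅K⁆ M) (hf : Function.Surjective f) :
    ∃ (r₀ : Fin t) (c : {r : Fin t // r ≠ r₀} → K) (U : Submodule K (Fin n → K)),
      Module.finrank K ((Fin n → K) ⧸ U) ≤ k ∧
      ∀ x ∈ U, ∀ y, (Φ.φ r₀ - ∑ r, c r • Φ.φ r) x y = 0 := by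
  classical
  push Not at hna
  obtain ⟨x₀, y₀, hz⟩ := hna
  obtain ⟨a₀, rfl⟩ := hf x₀
  obtain ⟨b₀, rfl⟩ := hf y₀
  set z : M := ⁅f a₀, f b₀⁆ with hzdef
  let i₁ : (Fin n → K) →ₗ[K] Φ.L := LinearMap.inl K (Fin n → K) (Fin t → K)
  let i₂ : (Fin t → K) →ₗ[K] Φ.L := LinearMap.inr K (Fin n → K) (Fin t → K)
  have hbr (a b : Φ.L) : ⁅f a, f b⁆ = f (i₂ fun r => Φ.φ r a.1 b.1) := by
    rw [← LieHom.map_lie]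
    rfl
  have hcentral (y : M) : ⁅z, y⁆ = 0 := by
    obtain ⟨y, rfl⟩ := hf y
    rw [hzdef, hbr, hbr]
    have : (fun r => Φ.φ r (i₂ fun r => Φ.φ r a₀.1 b₀.1).1 y.1) = 0 := by
      funext r
      exact LinearMap.congr_fun (map_zero (Φ.φ r)) y.1
    rw [this, map_zero, map_zero]
  obtain ⟨lam, hlam⟩ : ∃ lam : Module.Dual K M, lam z ≠ 0 := by
    by_contra! h
    exact hz ((Module.forall_dual_apply_eq_zero_iff K z).1 h)
  let F : (Fin t → K) →ₗ[K] K := lam ∘ₗ (f : Φ.L →ₗ[K] M) ∘ₗ i₂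
  let d : Fin t → K := fun r => F fun j => if r = j then 1 else 0
  have hd (a b : Φ.L) : lam ⁅f a, f b⁆ = ∑ r, d r * Φ.φ r a.1 b.1 := by
    rw [hbr]
    change F _ = _
    rw [LinearMap.pi_apply_eq_sum_univ F]
    exact Finset.sum_congr rfl fun r _ => mul_comm _ _
  obtain ⟨r₀, hr₀⟩ : ∃ r, d r ≠ 0 := by
    by_contra! h0
    exact hlam (by rw [hzdef, hd]; simp [h0])
  let g : (Fin n → K) →ₗ[K] M ⧸ (K ∙ z) := (K ∙ z).mkQ ∘ₗ (f : Φ.L →ₗ[K] M) ∘ₗ i₁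
  refine ⟨r₀, fun r => -((d r₀)⁻¹ * d r), LinearMap.ker g, ?_, fun x hx y => ?_⟩
  · rw [g.quotKerEquivRange.finrank_eq]
    have h1 := Submodule.finrank_quotient_add_finrank (K ∙ z)
    have h2 := finrank_span_singleton (K := K) hz
    have h3 := Submodule.finrank_le (LinearMap.range g)
    omega
  · have hx' : f (i₁ x) ∈ K ∙ z := by
      rw [← (K ∙ z).ker_mkQ]
      exact hx
    obtain ⟨s, hs⟩ := Submodule.mem_span_singleton.1 hx'
    have h0 : ∑ r, d r * Φ.φ r x y = 0 := by
      have := hd (i₁ x) (i₁ y)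
      rw [← hs, smul_lie, hcentral, smul_zero, map_zero] at this
      exact this.symm
    have hsum : ∑ r, (d r₀)⁻¹ * (d r * Φ.φ r x y) = 0 := by
      rw [← Finset.mul_sum, h0, mul_zero]
    rw [Fintype.sum_eq_add_sum_subtype_ne _ r₀, inv_mul_cancel_left₀ hr₀] at hsum
    rw [← hsum]
    simp [LinearMap.sum_apply, mul_assoc, sub_eq_add_neg]

/-- The upper triangular entries of a tuple of alternating forms. -/
def upperPoint (Φ : AltTuple K n t) (q : Fin t × UpperPair n) : K :=
  Φ.evalPoint (q.1, q.2.1)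

theorem exists_upperPoint_eq_paramEntry (Φ : AltTuple K n t) {M : Type} [LieRing M]
    [LieAlgebra K M] [Module.Finite K M] {k m : ℕ} (hk : k + m = n)
    (hM : Module.finrank K M ≤ k + 1) (hna : ¬ ∀ x y : M, ⁅x, y⁆ = 0)
    (f : Φ.L →ₗ⁅K⁆ M) (hf : Function.Surjective f) :
    ∃ (e : Fin k ⊕ Fin m ≃ Fin n) (r₀ : Fin t) (x : Param k m n r₀ → K),
      Φ.upperPoint = paramEntry e r₀ x := by
  obtain ⟨r₀, c, U, hU, hUω⟩ := Φ.exists_radical_of_surjective hM hna f hf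
  have hω : LinearMap.BilinForm.IsAlt (Φ.φ r₀ - ∑ r, c r • Φ.φ r) := fun x => by
    simp [LinearMap.sum_apply, (Φ.alt _).self_eq_zero x]
  obtain ⟨e, C, b, h⟩ := exists_lowRankEntry_eq hk hω U hU hUω
  refine ⟨e, r₀, Sum.elim (Sum.elim (fun p => Φ.upperPoint (p.1, p.2)) c) (Sum.elim C b), ?_⟩
  funext ⟨r, p⟩
  unfold paramEntry
  split_ifs with hr
  · subst hr
    have := h p.1.1 p.1.2
    simp only [LinearMap.sub_apply, LinearMap.sum_apply, LinearMap.smul_apply, smul_eq_mul,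
      sub_eq_iff_eq_add] at this
    simpa [upperPoint, evalPoint] using this
  · rfl

/-- The tuple of alternating forms with the given upper triangular entries. -/
def ofUpper (x : Fin t × UpperPair n → K) : AltTuple K n t where
  φ r := LinearMap.mk₂ K
    (fun u v => ∑ p : UpperPair n, x (r, p) * (u p.1.1 * v p.1.2 - u p.1.2 * v p.1.1))
    (fun u u' v => by
      rw [← Finset.sum_add_distrib]
      exact Finset.sum_congr rfl fun p _ => by simp only [Pi.add_apply]; ring)
    (fun c u v => by
      rw [smul_eq_mul, Finset.mul_sum]
      exact Finset.sum_congr rfl fun p _ => by simp only [Pi.smul_apply, smul_eq_mul]; ring)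
    (fun u v v' => by
      rw [← Finset.sum_add_distrib]
      exact Finset.sum_congr rfl fun p _ => by simp only [Pi.add_apply]; ring)
    (fun c u v => by
      rw [smul_eq_mul, Finset.mul_sum]
      exact Finset.sum_congr rfl fun p _ => by simp only [Pi.smul_apply, smul_eq_mul]; ring)
  alt r u := by
    rw [LinearMap.mk₂_apply]
    exact Finset.sum_eq_zero fun p _ => by ring

theorem upperPoint_ofUpper (x : Fin t × UpperPair n → K) : (ofUpper x).upperPoint = x := by
  funext ⟨r, ⟨⟨i, j⟩, hij⟩⟩
  have hij' : i < j := hij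
  simp only [upperPoint, evalPoint, ofUpper, LinearMap.mk₂_apply]
  rw [Finset.sum_eq_single ⟨(i, j), hij⟩]
  · simp [hij'.ne]
  · rintro ⟨⟨i', j'⟩, h⟩ - hne
    have h' : i' < j' := h
    have hne' : ¬ (i' = i ∧ j' = j) := by
      rintro ⟨rfl, rfl⟩
      exact hne rfl
    simp only [Pi.single_apply]
    split_ifs <;> first | omega | simp
  · simp

/-- Linear independence of a tuple of alternating forms holds off the zero locus of a nonzero
polynomial in the upper triangular entries. -/
theorem exists_linearIndependent_of_eval_ne_zero (htop : 2 * t ≤ n * (n - 1)) :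
    ∃ D : MvPolynomial (Fin t × UpperPair n) K, D ≠ 0 ∧
      ∀ Φ : AltTuple K n t, MvPolynomial.eval Φ.upperPoint D ≠ 0 → LinearIndependent K Φ.φ := by
  obtain ⟨s⟩ : Nonempty (Fin t ↪ UpperPair n) :=
    Function.Embedding.nonempty_of_card_le (by
      have := card_upperPair_mul_two n
      rw [Fintype.card_fin]
      omega)
  let A : Matrix (Fin t) (Fin t) (MvPolynomial (Fin t × UpperPair n) K) :=
    Matrix.of fun i j => MvPolynomial.X (i, s j)
  have hA (y : Fin t × UpperPair n → K) :
      MvPolynomial.eval y A.det = (Matrix.of fun i j => y (i, s j)).det := by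
    rw [RingHom.map_det]
    congr 1
    ext i j
    simp [A]
  refine ⟨A.det, fun h => ?_, fun Φ hΦ => ?_⟩
  · have h1 := hA fun q => if s q.1 = q.2 then 1 else 0
    have h2 : (Matrix.of fun i j => if s i = s j then (1 : K) else 0 :
        Matrix (Fin t) (Fin t) K) = 1 := by
      ext i j
      simp [Matrix.one_apply]
    rw [h, map_zero] at h1
    exact zero_ne_one (h1.trans ((congrArg Matrix.det h2).trans Matrix.det_one))
  · rw [hA] at hΦ
    let g : LinearMap.BilinForm K (Fin n → K) →ₗ[K] (Fin t → K) :=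
      { toFun := fun ω j => ω (Pi.single (s j).1.1 1) (Pi.single (s j).1.2 1)
        map_add' := fun _ _ => rfl
        map_smul' := fun _ _ => rfl }
    exact LinearIndependent.of_comp g (Matrix.linearIndependent_rows_of_det_ne_zero hΦ)

/-- Off the zero locus of a nonzero polynomial in the upper triangular entries, `L(Φ)` does not
surject onto a non-abelian Lie algebra of dimension at most `k + 1`. -/
theorem exists_upper_polynomial {k m : ℕ} (hk : k + m = n) (h : 2 * t < m * (m - 1) + 2) :
    ∃ P : MvPolynomial (Fin t × UpperPair n) K, P ≠ 0 ∧
      ∀ (Φ : AltTuple K n t) (M : Type) [LieRing M] [LieAlgebra K M] [Module.Finite K M],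
        Module.finrank K M ≤ k + 1 → (¬ ∀ x y : M, ⁅x, y⁆ = 0) →
        ∀ f : Φ.L →ₗ⁅K⁆ M, Function.Surjective f → MvPolynomial.eval Φ.upperPoint P = 0 := by
  choose Q hQ0 hQ using fun q : (Fin k ⊕ Fin m ≃ Fin n) × Fin t =>
    exists_ne_zero_aeval_eq_zero (paramEntry q.1 q.2 (MvPolynomial.X (R := K)))
      (card_param_lt q.2 hk h)
  refine ⟨∏ q, Q q, Finset.prod_ne_zero_iff.2 fun q _ => hQ0 q, ?_⟩
  intro Φ M _ _ _ hM hna f hf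
  obtain ⟨e, r₀, x, hx⟩ := Φ.exists_upperPoint_eq_paramEntry hk hM hna f hf
  rw [map_prod]
  refine Finset.prod_eq_zero (Finset.mem_univ (e, r₀)) ?_
  have hpt : Φ.upperPoint =
      fun q => MvPolynomial.aeval x (paramEntry e r₀ (MvPolynomial.X (R := K)) q) := by
    funext q
    rw [hx]
    exact (congrArg (paramEntry e r₀ · q) (by ext; simp)).trans
      (map_paramEntry (MvPolynomial.aeval x : _ →ₐ[K] K).toRingHom e r₀ MvPolynomial.X q).symm
  rw [hpt, ← MvPolynomial.coe_aeval_eq_eval, RingHom.coe_coe, ← MvPolynomial.comp_aeval_apply,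
    hQ (e, r₀), map_zero]

/-- Generic form of the theorem: the polynomial can be chosen not to vanish identically on
linearly independent tuples of alternating forms. -/
theorem exists_polynomial_generic [Infinite K] {N : ℕ} (hN : 0 < N) (hNn : N < n)
    (htop : 2 * t ≤ n * (n - 1))
    (hineq : 2 * (t : ℤ)
        < (n : ℤ) ^ 2 - (n : ℤ) * (2 * (N : ℤ) - 1) + (N : ℤ) * ((N : ℤ) - 1) + 2) :
    ∃ P : MvPolynomial (Fin t × Fin n × Fin n) K,
      (∃ Φ : AltTuple K n t, LinearIndependent K Φ.φ ∧ MvPolynomial.eval Φ.evalPoint P ≠ 0) ∧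
      ∀ (Φ : AltTuple K n t) (M : Type) [LieRing M] [LieAlgebra K M] [Module.Finite K M],
        Module.finrank K M = N → (¬ ∀ x y : M, ⁅x, y⁆ = 0) →
        ∀ f : Φ.L →ₗ⁅K⁆ M, Function.Surjective f → MvPolynomial.eval Φ.evalPoint P = 0 := by
  obtain ⟨k, rfl⟩ : ∃ k, N = k + 1 := ⟨N - 1, by omega⟩
  obtain ⟨m, rfl⟩ : ∃ m, n = k + (m + 1) := ⟨n - k - 1, by omega⟩
  have hm : 2 * t < (m + 1) * (m + 1 - 1) + 2 := by
    rw [Nat.add_sub_cancel]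
    zify
    push_cast at hineq
    linarith
  obtain ⟨Q, hQ0, hQ⟩ := exists_upper_polynomial (K := K) rfl hm
  obtain ⟨D, hD0, hD⟩ := exists_linearIndependent_of_eval_ne_zero (K := K) htop
  obtain ⟨x, hx⟩ : ∃ x, MvPolynomial.eval x (Q * D) ≠ 0 := by
    by_contra! hx
    exact mul_ne_zero hQ0 hD0 (MvPolynomial.funext fun x => by rw [hx, map_zero])
  rw [map_mul] at hx
  have heval (Φ : AltTuple K (k + (m + 1)) t) :
      MvPolynomial.eval Φ.evalPoint (MvPolynomial.rename (fun q => (q.1, q.2.1)) Q) =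
        MvPolynomial.eval Φ.upperPoint Q := by
    rw [MvPolynomial.eval_rename]
    rfl
  refine ⟨MvPolynomial.rename (fun q => (q.1, q.2.1)) Q, ⟨ofUpper x, hD _ ?_, ?_⟩, ?_⟩
  · rw [upperPoint_ofUpper]
    exact right_ne_zero_of_mul hx
  · rw [heval, upperPoint_ofUpper]
    exact left_ne_zero_of_mul hx
  · intro Φ M _ _ _ hM hna f hf
    rw [heval]
    exact hQ Φ M hM.le hna f hf

end AltTuple


/-- If N < n and 2t < n² − n(2N−1) + N(N−1) + 2, then there is a nonzero
polynomial in the matrix entries vanishing at every linearly independent tuple Φ of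
alternating forms for which L(Φ) surjects onto some non-abelian Lie algebra of
dimension N; i.e. a generic Lie algebra of 𝔑₂(n,t) admits no surjective homomorphism
onto a non-commutative Lie algebra of dimension N. -/
theorem generic_no_surjection_onto_nonabelian
    (K : Type) [Field K] [Infinite K] (n N t : ℕ)
    (hN : 0 < N) (hNn : N < n) (ht : 0 < t) (htop : 2 * t ≤ n * (n - 1))
    (hineq : 2 * (t : ℤ)
        < (n : ℤ) ^ 2 - (n : ℤ) * (2 * (N : ℤ) - 1) + (N : ℤ) * ((N : ℤ) - 1) + 2) :
    ∃ P : MvPolynomial (Fin t × Fin n × Fin n) K, P ≠ 0 ∧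
      ∀ Φ : AltTuple K n t, LinearIndependent K Φ.φ →
        (∃ (M : Type) (_ : LieRing M) (_ : LieAlgebra K M) (_ : Module.Finite K M),
          Module.finrank K M = N ∧ ¬ (∀ x y : M, ⁅x, y⁆ = 0) ∧
          ∃ f : Φ.L →ₗ⁅K⁆ M, Function.Surjective f) →
        MvPolynomial.eval Φ.evalPoint P = 0 := by
  obtain ⟨P, ⟨Φ₀, _, hΦ₀⟩, hP⟩ :=
    AltTuple.exists_polynomial_generic (K := K) hN hNn htop hineq
  refine ⟨P, fun h => hΦ₀ (by rw [h, map_zero]), ?_⟩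
  rintro Φ - ⟨M, _, _, _, hM, hna, f, hf⟩
  exact hP Φ M hM hna f hf
end

section
/- Let K be a field and n, n₀, t, t₀, k positive integers. Suppose that every finite-dimensional 2-step nilpotent Lie algebra over K with dim L/[L,L] = n and dim [L,L] = t admits a surjective Lie algebra homomorphism onto some finite-dimensional 2-step nilpotent Lie algebra M with dim M/[M,M] = n₀ and dim [M,M] = t₀. Then every finite-dimensional 2-step nilpotent Lie algebra L' over K with dim L'/[L',L'] = n and dim [L',L'] = t + k also admits such a surjective homomorphism. -/
/-- A finite-dimensional vector space has subspaces of every smaller dimension. -/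
theorem Submodule.exists_le_finrank_eq {K V : Type*} [Field K] [AddCommGroup V] [Module K V]
    [Module.Finite K V] (C : Submodule K V) {k : ℕ} (hk : k ≤ Module.finrank K C) :
    ∃ W ≤ C, Module.finrank K W = k := by
  let v : Fin k → V := fun i => Module.finBasis K C (Fin.castLE hk i)
  have hv : LinearIndependent K v :=
    ((Module.finBasis K C).linearIndependent.comp _ (Fin.castLE_injective hk)).map'
      C.subtype C.ker_subtype
  refine ⟨Submodule.span K (Set.range v), ?_, ?_⟩
  · rw [Submodule.span_le]
    rintro _ ⟨i, rfl⟩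
    exact SetLike.coe_mem _
  · rw [finrank_span_eq_card hv, Fintype.card_fin]

theorem commSubmodule_eq_bot {K L : Type} [Field K] [LieRing L] [LieAlgebra K L]
    (h : ∀ x y : L, ⁅x, y⁆ = 0) : commSubmodule K L = ⊥ := by
  rw [commSubmodule_eq_span, Submodule.span_eq_bot]
  rintro _ ⟨x, y, rfl⟩
  exact h x y

theorem Is2StepNilpotent.lie_eq_zero {K L : Type} [Field K] [LieRing L] [LieAlgebra K L]
    (h : Is2StepNilpotent L) (x : L) {z : L} (hz : z ∈ commSubmodule K L) : ⁅x, z⁆ = 0 := by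
  rw [commSubmodule_eq_span] at hz
  induction hz using Submodule.span_induction with
  | mem z hz => obtain ⟨y, w, rfl⟩ := hz; exact h.1 x y w
  | zero => exact lie_zero x
  | add y z _ _ hy hz => rw [lie_add, hy, hz, add_zero]
  | smul a z _ hz => rw [lie_smul, hz, smul_zero]

/-- Every subspace of the commutator ideal of a 2-step nilpotent Lie algebra is the kernel of a
surjective homomorphism of Lie algebras. -/
theorem Is2StepNilpotent.exists_surjective_ker_eq {K L : Type} [Field K] [LieRing L]
    [LieAlgebra K L] (h : Is2StepNilpotent L) (W : Submodule K L) (hW : W ≤ commSubmodule K L) :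
    ∃ (M : Type) (_ : LieRing M) (_ : LieAlgebra K M) (f : L →ₗ⁅K⁆ M),
      Function.Surjective f ∧ LinearMap.ker (f : L →ₗ[K] M) = W := by
  let I : LieIdeal K L :=
    { W with
      lie_mem := fun {x z} hz => by
        rw [h.lie_eq_zero x (hW hz)]
        exact W.zero_mem }
  let f : L →ₗ⁅K⁆ L ⧸ I :=
    { I.toSubmodule.mkQ with map_lie' := fun {x y} => LieSubmodule.Quotient.mk_bracket I x y }
  exact ⟨L ⧸ I, inferInstance, inferInstance, f, I.toSubmodule.mkQ_surjective,
    I.toSubmodule.ker_mkQ⟩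

theorem map_commSubmodule_of_surjective {K L M : Type} [Field K] [LieRing L] [LieAlgebra K L]
    [LieRing M] [LieAlgebra K M] (f : L →ₗ⁅K⁆ M) (hf : Function.Surjective f) :
    (commSubmodule K L).map (f : L →ₗ[K] M) = commSubmodule K M := by
  rw [commSubmodule_eq_span, commSubmodule_eq_span, Submodule.map_span]
  congr 1
  ext z
  constructor
  · rintro ⟨_, ⟨x, y, rfl⟩, rfl⟩
    exact ⟨f x, f y, (f.map_lie x y).symm⟩
  · rintro ⟨x, y, rfl⟩
    obtain ⟨x, rfl⟩ := hf x
    obtain ⟨y, rfl⟩ := hf y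
    exact ⟨⁅x, y⁆, ⟨x, y, rfl⟩, f.map_lie x y⟩

theorem Submodule.finrank_map_add_finrank_ker_of_le {K V V' : Type*} [Field K] [AddCommGroup V]
    [Module K V] [Module.Finite K V] [AddCommGroup V'] [Module K V'] (f : V →ₗ[K] V')
    (C : Submodule K V) (h : LinearMap.ker f ≤ C) :
    Module.finrank K (C.map f) + Module.finrank K (LinearMap.ker f) = Module.finrank K C := by
  rw [← (f.domRestrict C).finrank_range_add_finrank_ker, LinearMap.range_domRestrict,
    LinearMap.ker_domRestrict, (Submodule.comapSubtypeEquivOfLe h).finrank_eq]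

/-- If every finite-dimensional 2-step nilpotent Lie algebra over K with
dim L/[L,L] = n, dim [L,L] = t has property Σ(n₀,t₀), then so does every one with
dim L'/[L',L'] = n, dim [L',L'] = t + k. -/
theorem hasSigma_mono_in_t
    (K : Type) [Field K] (n t n₀ t₀ k : ℕ)
    (hn : 0 < n) (ht : 0 < t) (hn₀ : 0 < n₀) (ht₀ : 0 < t₀) (hk : 0 < k)
    (hall : ∀ (L : Type) (_ : LieRing L) (_ : LieAlgebra K L) (_ : Module.Finite K L),
      Is2StepNilpotent L →
      Module.finrank K (L ⧸ commSubmodule K L) = n →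
      Module.finrank K (commSubmodule K L) = t →
      HasSigma K L n₀ t₀) :
    ∀ (L' : Type) (_ : LieRing L') (_ : LieAlgebra K L') (_ : Module.Finite K L'),
      Is2StepNilpotent L' →
      Module.finrank K (L' ⧸ commSubmodule K L') = n →
      Module.finrank K (commSubmodule K L') = t + k →
      HasSigma K L' n₀ t₀ := by
  intro L' _ _ _ h2 hn' ht'
  obtain ⟨W, hW, hWk⟩ :=
    (commSubmodule K L').exists_le_finrank_eq (k := k) (by omega)
  obtain ⟨L, _, _, f, hf, hker⟩ := h2.exists_surjective_ker_eq W hW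
  have : Module.Finite K L := Module.Finite.of_surjective (f : L' →ₗ[K] L) hf
  have hder : Module.finrank K (commSubmodule K L) = t := by
    have h := Submodule.finrank_map_add_finrank_ker_of_le (f : L' →ₗ[K] L) _ (hker.trans_le hW)
    rw [map_commSubmodule_of_surjective f hf, hker] at h
    omega
  have hquot : Module.finrank K (L ⧸ commSubmodule K L) = n := by
    have h := (f : L' →ₗ[K] L).finrank_range_add_finrank_ker
    rw [LinearMap.range_eq_top.2 hf, finrank_top, hker] at h
    have hL := (commSubmodule K L).finrank_quotient_add_finrank
    have hL' := (commSubmodule K L').finrank_quotient_add_finrank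
    omega
  have hnil : Is2StepNilpotent L := by
    refine ⟨fun x y z => ?_, fun h => ?_⟩
    · obtain ⟨x, rfl⟩ := hf x
      obtain ⟨y, rfl⟩ := hf y
      obtain ⟨z, rfl⟩ := hf z
      rw [← f.map_lie, ← f.map_lie, h2.1, map_zero]
    · rw [commSubmodule_eq_bot h, finrank_bot] at hder
      omega
  obtain ⟨M, _, _, hfin, hM, g, hg⟩ := hall L _ _ this hnil hquot hder
  exact ⟨M, _, _, hfin, hM, g.comp f, hg.comp hf⟩
end
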